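/- arXiv:0705.2492 — 2 statements merged into one kernel-verified Lean document; each statement's English description precedes it below -/
import Mathlib

section
/- Let K be a field of characteristic zero, X an irreducible locally nilpotent K-derivation of K[x,y,z], and let c be a generator of its plinth ideal S^X (as an ideal of the ring of constants K[x,y,z]^X). Then rank(X) = 1 if and only if c is a nonzero element of K. -/
noncomputable section

variable (K : Type) [Field K] [CharZero K]

abbrev PolyR (K : Type) [Field K] : Type := MvPolynomial (Fin 3) K

/-- A derivation is locally nilpotent if every element is killed by some iterate. -/
def LND (X : Derivation K (PolyR K) (PolyR K)) : Prop :=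
  ∀ a : PolyR K, ∃ n : ℕ, 0 < n ∧ (⇑X)^[n] a = 0

/-- `X` is irreducible: every common divisor of `X x, X y, X z` is a unit. -/
def IrredDer (X : Derivation K (PolyR K) (PolyR K)) : Prop :=
  ∀ d : PolyR K, (∀ i : Fin 3, d ∣ X (MvPolynomial.X i)) → IsUnit d

def IsCoord (f : PolyR K) : Prop :=
  ∃ g h : PolyR K, Algebra.adjoin K {f, g, h} = ⊤

def IsCoordSys (u v w : PolyR K) : Prop := Algebra.adjoin K {u, v, w} = ⊤

def IsSysOfCoords2 (u v : PolyR K) : Prop :=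
  ∃ w : PolyR K, Algebra.adjoin K {u, v, w} = ⊤

/-- The corank of a derivation: the largest length of a system of coordinates in the kernel. -/
def corank (X : Derivation K (PolyR K) (PolyR K)) : ℕ :=
  sSup {r : ℕ | ∃ l : List (PolyR K), l.length = r ∧ (∀ f ∈ l, X f = 0) ∧
    ∃ m : List (PolyR K), (l ++ m).length = 3 ∧
      Algebra.adjoin K {a : PolyR K | a ∈ l ++ m} = ⊤}

def rankD (X : Derivation K (PolyR K) (PolyR K)) : ℕ := 3 - corank K X

def IsLocalSlice (X : Derivation K (PolyR K) (PolyR K)) (s : PolyR K) : Prop :=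
  X s ≠ 0 ∧ X (X s) = 0

def IsMinLocalSlice (X : Derivation K (PolyR K) (PolyR K)) (s : PolyR K) : Prop :=
  IsLocalSlice K X s ∧ ∀ v : PolyR K, IsLocalSlice K X v → X v ∣ X s →
    ∃ μ : (PolyR K)ˣ, X v = (μ : PolyR K) * X s

/-- `c` generates the plinth ideal `S^X = {X a : X² a = 0}` as an ideal of the constants. -/
def IsPlinthGen (X : Derivation K (PolyR K) (PolyR K)) (c : PolyR K) : Prop :=
  {d : PolyR K | ∃ a : PolyR K, X a = d ∧ X (X a) = 0} =
    {d : PolyR K | ∃ r : PolyR K, X r = 0 ∧ d = r * c}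

/-- `X` is triangulable: triangular in some coordinate system. -/
def Triangulable (X : Derivation K (PolyR K) (PolyR K)) : Prop :=
  ∃ u v w : PolyR K, IsCoordSys K u v w ∧
    X u ∈ (⊥ : Subalgebra K (PolyR K)) ∧
    X v ∈ Algebra.adjoin K {u} ∧
    X w ∈ Algebra.adjoin K {u, v}

/-- Evaluation of `Q ∈ K[u][T]` at `T = t`, with coefficients evaluated at `u`. -/
def ev2 (u t : PolyR K) (Q : Polynomial (Polynomial K)) : PolyR K :=
  Polynomial.eval₂ (Polynomial.aeval u).toRingHom t Q

/-- The Jacobian derivation `Jac(f,g,·)` applied to `h`. -/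
def jacDet (f g h : PolyR K) : PolyR K :=
  Matrix.det !![MvPolynomial.pderiv 0 f, MvPolynomial.pderiv 1 f, MvPolynomial.pderiv 2 f;
    MvPolynomial.pderiv 0 g, MvPolynomial.pderiv 1 g, MvPolynomial.pderiv 2 g;
    MvPolynomial.pderiv 0 h, MvPolynomial.pderiv 1 h, MvPolynomial.pderiv 2 h]



namespace Canc

open Polynomial

set_option linter.unusedSectionVars false

section basics

variable {k B : Type} [Field k] [CommRing B] [IsDomain B] [CharZero B] [Algebra k B]

/-- Local nilpotency of a derivation. -/
def Lnil (D : Derivation k B B) : Prop := ∀ a, ∃ n : ℕ, (⇑D)^[n] a = 0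

/-- The ring of constants as a subalgebra. -/
def kerS (D : Derivation k B B) : Subalgebra k B where
  carrier := {a | D a = 0}
  mul_mem' := by
    intro a b ha hb
    simp only [Set.mem_ofPred_eq] at *
    simp [ha, hb]
  add_mem' := by
    intro a b ha hb
    simp only [Set.mem_ofPred_eq] at *
    simp [ha, hb]
  algebraMap_mem' := by
    intro r
    simp

lemma mem_kerS {D : Derivation k B B} {a : B} : a ∈ kerS D ↔ D a = 0 := Iff.rfl

lemma iter_zero_of_le {D : Derivation k B B} {a : B} {m n : ℕ} (h : m ≤ n)
    (ha : (⇑D)^[m] a = 0) : (⇑D)^[n] a = 0 := by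
  obtain ⟨j, rfl⟩ := Nat.exists_eq_add_of_le h
  rw [add_comm, Function.iterate_add_apply, ha, iterate_map_zero]

lemma iter_const {D : Derivation k B B} {a : B} (ha : D a = 0) (b : B) (n : ℕ) :
    (⇑D)^[n] (a * b) = a * (⇑D)^[n] b := by
  induction n generalizing b with
  | zero => rfl
  | succ n ih => rw [Function.iterate_succ_apply, Function.iterate_succ_apply]; simp [ha, ih]

lemma iter_mul (D : Derivation k B B) (N : ℕ) : ∀ (m n : ℕ) (a b : B), m + n = N →
    (⇑D)^[m+1] a = 0 → (⇑D)^[n+1] b = 0 →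
    (⇑D)^[N] (a * b) = (N.choose m : B) * ((⇑D)^[m] a * (⇑D)^[n] b) ∧
    (⇑D)^[N+1] (a * b) = 0 := by
  induction N with
  | zero =>
    intro m n a b h ha hb
    obtain ⟨rfl, rfl⟩ : m = 0 ∧ n = 0 := by omega
    simp at ha hb
    simp [ha, hb]
  | succ N ih =>
    intro m n a b h ha hb
    rcases m with _ | m
    · have ha' : D a = 0 := ha
      obtain rfl : n = N + 1 := by omega
      refine ⟨?_, ?_⟩
      · rw [iter_const ha']; simp
      · rw [iter_const ha', hb, mul_zero]
    rcases n with _ | n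
    · have hb' : D b = 0 := hb
      obtain rfl : m = N := by omega
      refine ⟨?_, ?_⟩
      · rw [mul_comm, iter_const hb']; simp; ring
      · rw [mul_comm, iter_const hb', ha, mul_zero]
    · have h1 := ih (m+1) n a (D b) (by omega) ha hb
      have h2 := ih m (n+1) (D a) b (by omega) ha hb
      have key : D (a * b) = a * D b + D a * b := by simp; ring
      refine ⟨?_, ?_⟩
      · rw [Function.iterate_succ_apply, key, iterate_map_add, h1.1, h2.1, Nat.choose_succ_succ]
        simp only [← Function.iterate_succ_apply]
        push_cast
        ring
      · rw [Function.iterate_succ_apply, key, iterate_map_add, h1.2, h2.2, add_zero]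

lemma exists_index {D : Derivation k B B} (hD : Lnil D) {a : B} (ha : a ≠ 0) :
    ∃ m, (⇑D)^[m] a ≠ 0 ∧ (⇑D)^[m+1] a = 0 := by
  classical
  have h := hD a
  have h0 : Nat.find h ≠ 0 := by
    intro h0
    have := Nat.find_spec h
    rw [h0] at this
    exact ha this
  obtain ⟨m, hm⟩ := Nat.exists_eq_succ_of_ne_zero h0
  refine ⟨m, Nat.find_min h (by omega), ?_⟩
  have := Nat.find_spec h
  rwa [hm] at this

lemma mul_index {D : Derivation k B B} {a b : B} {m n : ℕ}
    (ha : (⇑D)^[m] a ≠ 0) (ha' : (⇑D)^[m+1] a = 0) (hb : (⇑D)^[n] b ≠ 0)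
    (hb' : (⇑D)^[n+1] b = 0) : (⇑D)^[m+n] (a*b) ≠ 0 := by
  rw [(iter_mul D (m+n) m n a b rfl ha' hb').1]
  refine mul_ne_zero ?_ (mul_ne_zero ha hb)
  exact_mod_cast (Nat.choose_pos (by omega)).ne'

lemma fact_closed {D : Derivation k B B} (hD : Lnil D) {a b : B} (hab : a * b ≠ 0)
    (h : D (a * b) = 0) : D a = 0 ∧ D b = 0 := by
  obtain ⟨m, hm, hm'⟩ := exists_index hD (left_ne_zero_of_mul hab)
  obtain ⟨n, hn, hn'⟩ := exists_index hD (right_ne_zero_of_mul hab)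
  have := mul_index hm hm' hn hn'
  have h0 : m + n = 0 := by
    by_contra h0
    exact this (iter_zero_of_le (m := 1) (by omega) h)
  obtain ⟨rfl, rfl⟩ : m = 0 ∧ n = 0 := by omega
  exact ⟨hm', hn'⟩

lemma dvd_self_zero {D : Derivation k B B} (hD : Lnil D) {x : B} (h : x ∣ D x) : D x = 0 := by
  by_contra hne
  obtain ⟨u, hu⟩ := h
  have hxu : x * u ≠ 0 := hu ▸ hne
  obtain ⟨m, hm, hm'⟩ := exists_index hD (left_ne_zero_of_mul hxu)
  obtain ⟨n, hn, hn'⟩ := exists_index hD (right_ne_zero_of_mul hxu)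
  apply mul_index hm hm' hn hn'
  rw [← hu]
  exact iter_zero_of_le (m := m) (by omega) hm'

lemma exists_local_slice {D : Derivation k B B} (hD : Lnil D) (h0 : ∃ a, D a ≠ 0) :
    ∃ a, D a ≠ 0 ∧ D (D a) = 0 := by
  obtain ⟨a, ha⟩ := h0
  obtain ⟨m, hm, hm'⟩ := exists_index hD ha
  refine ⟨(⇑D)^[m] a, ?_, ?_⟩
  · rwa [← Function.iterate_succ_apply' D, Function.iterate_succ_apply]
  · rwa [← Function.iterate_succ_apply' D, ← Function.iterate_succ_apply' D,
      Function.iterate_succ_apply]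

lemma der_aeval (D : Derivation k B B) (a : B) (P : (kerS D)[X]) :
    D (aeval a P) = aeval a (derivative P) * D a := by
  induction P using Polynomial.induction_on' with
  | add p q hp hq => simp [hp, hq, add_mul]
  | monomial n c =>
    have hc : D (c : B) = 0 := c.2
    simp only [aeval_monomial, derivative_monomial]
    have h2 : (algebraMap (kerS D) B c) = (c : B) := rfl
    rw [map_mul (algebraMap (kerS D) B), map_natCast, h2]
    simp [hc, Derivation.leibniz_pow]
    ring

lemma transc_of_slice {D : Derivation k B B} {a : B} (ha : D a ≠ 0) :
    Transcendental (kerS D) a := by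
  rw [transcendental_iff]
  intro P
  induction h : P.natDegree using Nat.strong_induction_on generalizing P with
  | _ n ih =>
    intro hP
    have h1 : aeval a (derivative P) = 0 := by
      have := der_aeval D a P
      rw [hP, map_zero] at this
      exact (mul_eq_zero.mp this.symm).resolve_right ha
    have hconst : P.natDegree = 0 := by
      by_contra hne
      have h2 := ih _ (by rw [← h]; exact natDegree_derivative_lt hne) _ rfl h1
      exact hne (derivative_eq_zero.mp h2)
    rw [eq_C_of_natDegree_eq_zero hconst] at hP ⊢
    simp only [aeval_C] at hP
    have : P.coeff 0 = 0 := Subtype.ext hP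
    simp [this]

lemma iter_slice_pow {D : Derivation k B B} {s : B} (hs : D s = 1) (n : ℕ) :
    (⇑D)^[n] (s^n) = (n.factorial : B) := by
  induction n with
  | zero => simp
  | succ n ih =>
    rw [Function.iterate_succ_apply]
    have : D (s^(n+1)) = ((n+1 : ℕ) : B) * s^n := by
      rw [Derivation.leibniz_pow, hs]; simp
    rw [this, iter_const (by simp), ih, Nat.factorial_succ]
    push_cast; ring

lemma slice_surj [CharZero k] {D : Derivation k B B} (hD : Lnil D) {s : B} (hs : D s = 1) (a : B) :
    ∃ P : (kerS D)[X], aeval s P = a := by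
  obtain ⟨n, hn⟩ := hD a
  induction n generalizing a with
  | zero => exact ⟨0, by simpa using hn.symm⟩
  | succ n ih =>
    have hb : D ((⇑D)^[n] a) = 0 := by rwa [← Function.iterate_succ_apply' D]
    set b : kerS D := ⟨(⇑D)^[n] a, hb⟩
    have hfac : (n.factorial : k) ≠ 0 := by exact_mod_cast n.factorial_ne_zero
    set c : kerS D := algebraMap k (kerS D) ((n.factorial : k)⁻¹) * b
    have hc : D (c : B) = 0 := c.2
    obtain ⟨P, hP⟩ := ih (a - c * s^n) (by
      rw [iterate_map_sub, iter_const hc, iter_slice_pow hs]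
      have : (c : B) = algebraMap k B ((n.factorial : k)⁻¹) * (⇑D)^[n] a := rfl
      rw [this]
      have h2 : (n.factorial : B) = algebraMap k B (n.factorial : k) := by simp
      have h3 : algebraMap k B ((n.factorial : k)⁻¹) * algebraMap k B (n.factorial : k) = 1 := by
        rw [← map_mul, inv_mul_cancel₀ hfac, map_one]
      rw [h2]
      linear_combination (-(⇑D)^[n] a) * h3)
    refine ⟨P + C c * X^n, ?_⟩
    have h2 : (algebraMap (kerS D) B c) = (c : B) := rfl
    simp [hP, h2]

end basics

end Canc


namespace Canc

open Polynomial

set_option linter.unusedSectionVars false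

section graded

variable {k R : Type} [Field k] [CommRing R] [IsDomain R] [CharZero R] [Algebra k R]

/-- Graded piece of the homogeneous derivation. -/
def Lmap (δ : Derivation k R R) (b : R) (i : ℕ) (a : R) : R := δ a + (i : R) * b * a

/-- The homogeneous derivation of degree `d` of `R[X]` given by `δ` on `R` and `X ↦ b X^(d+1)`. -/
noncomputable def homDer (δ : Derivation k R R) (b : R) (d : ℕ) : Derivation k R[X] R[X] :=
  Derivation.mk'
    { toFun := fun p => p.sum (fun i a => monomial (i+d) (Lmap δ b i a))
      map_add' := by
        intro p q
        apply Polynomial.sum_add_index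
        · intro i; simp [Lmap]
        · intro i a c; rw [← map_add]; congr 1; simp only [Lmap, map_add]; ring
      map_smul' := by
        intro r p
        rw [Polynomial.sum_smul_index' p r _ (by intro i; simp [Lmap])]
        simp only [RingHom.id_apply, Polynomial.sum_def, Finset.smul_sum]
        refine Finset.sum_congr rfl fun i _ => ?_
        rw [Polynomial.smul_monomial]
        congr 1
        simp [Lmap] }
    (by
      intro p q
      induction p using Polynomial.induction_on' with
      | add p₁ p₂ h₁ h₂ => rw [add_mul, map_add, h₁, h₂, map_add]; simp only [smul_eq_mul]; ring
      | monomial n a =>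
        induction q using Polynomial.induction_on' with
        | add p₁ p₂ h₁ h₂ => rw [mul_add, map_add, h₁, h₂, map_add]; simp only [smul_eq_mul]; ring
        | monomial m c =>
          simp only [LinearMap.coe_mk, AddHom.coe_mk, monomial_mul_monomial, smul_eq_mul]
          rw [sum_monomial_index _ _ (by simp [Lmap]), sum_monomial_index _ _ (by simp [Lmap]),
            sum_monomial_index _ _ (by simp [Lmap]), monomial_mul_monomial, monomial_mul_monomial,
            show n + (m + d) = n + m + d by ring, show m + (n + d) = n + m + d by ring,
            ← map_add]
          congr 1
          simp only [Lmap, Derivation.leibniz, smul_eq_mul]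
          push_cast
          ring)

lemma homDer_monomial (δ : Derivation k R R) (b : R) (d i : ℕ) (a : R) :
    homDer δ b d (monomial i a) = monomial (i+d) (Lmap δ b i a) := by
  change (monomial i a).sum (fun i a => monomial (i+d) (Lmap δ b i a)) = _
  exact sum_monomial_index _ _ (by simp [Lmap])

/-- The top-degree coefficient derivation. -/
noncomputable def topDer (E : Derivation k R[X] R[X]) (d : ℕ) : Derivation k R R :=
  Derivation.mk'
    { toFun := fun a => (E (C a)).coeff d
      map_add' := by intro a b; simp
      map_smul' := by
        intro r a
        have : C (r • a) = r • C a := by rw [Polynomial.smul_C]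
        rw [this, Derivation.map_smul, coeff_smul]; rfl }
    (by intro a b; simp [coeff_C_mul])

lemma topDer_apply (E : Derivation k R[X] R[X]) (d : ℕ) (a : R) :
    topDer E d a = (E (C a)).coeff d := rfl

lemma E_monomial (E : Derivation k R[X] R[X]) (i : ℕ) (a : R) :
    E (monomial i a) = X^i * E (C a) + C ((i : R) * a) * (X^(i-1) * E X) := by
  rw [← C_mul_X_pow_eq_monomial, Derivation.leibniz, Derivation.leibniz_pow]
  simp only [smul_eq_mul, nsmul_eq_mul, map_mul, map_natCast]
  ring

lemma top_step (E : Derivation k R[X] R[X]) (d : ℕ) (h1 : ∀ a, (E (C a)).natDegree ≤ d)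
    (h2 : (E X).natDegree ≤ d + 1) (i : ℕ) (p : R[X]) (hp : p.natDegree ≤ i) :
    (E p).natDegree ≤ i + d ∧
      (E p).coeff (i + d) = Lmap (topDer E d) ((E X).coeff (d+1)) i (p.coeff i) := by
  have mono : ∀ j a, (E (monomial j a)).natDegree ≤ j + d ∧
      (E (monomial j a)).coeff (j + d) = Lmap (topDer E d) ((E X).coeff (d+1)) j a := by
    intro j a
    rw [E_monomial]
    constructor
    · refine natDegree_add_le_of_degree_le ?_ ?_
      · refine natDegree_mul_le_of_le (natDegree_X_pow_le _) (h1 a)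
      · rcases j with _ | j
        · simp
        · refine (natDegree_C_mul_le _ _).trans ?_
          refine (natDegree_mul_le_of_le (natDegree_X_pow_le _) h2).trans ?_
          simp; omega
    · rw [coeff_add, coeff_C_mul, add_comm j d, coeff_X_pow_mul, Lmap, topDer_apply]
      rcases j with _ | j
      · simp
      · rw [show d + (j+1) = d + 1 + j by ring, Nat.add_sub_cancel, coeff_X_pow_mul]
        push_cast; ring
  have hs := p.as_sum_range' (i+1) (by omega)
  have hE : E p = ∑ j ∈ Finset.range (i+1), E (monomial j (p.coeff j)) := by
    conv_lhs => rw [hs]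
    rw [map_sum]
  rw [hE]
  constructor
  · refine natDegree_sum_le_of_forall_le _ _ fun j hj => ?_
    have := Finset.mem_range.mp hj
    exact (mono j _).1.trans (by omega)
  · rw [finsetSum_coeff, Finset.sum_range_succ, (mono i _).2, Finset.sum_eq_zero, zero_add]
    intro j hj
    have := Finset.mem_range.mp hj
    exact coeff_eq_zero_of_natDegree_lt (lt_of_le_of_lt (mono j _).1 (by omega))

lemma homDer_iter (E : Derivation k R[X] R[X]) (d : ℕ) (h1 : ∀ a, (E (C a)).natDegree ≤ d)
    (h2 : (E X).natDegree ≤ d + 1) (i : ℕ) (a : R) (n : ℕ) :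
    ((⇑E)^[n] (monomial i a)).natDegree ≤ i + n * d ∧
    (⇑(homDer (topDer E d) ((E X).coeff (d+1)) d))^[n] (monomial i a) =
      monomial (i + n * d) (((⇑E)^[n] (monomial i a)).coeff (i + n * d)) := by
  induction n with
  | zero => simp [natDegree_monomial_le]
  | succ n ih =>
    have := top_step E d h1 h2 _ _ ih.1
    rw [Function.iterate_succ_apply', Function.iterate_succ_apply', ih.2, homDer_monomial,
      show i + (n+1)*d = i + n * d + d by ring, this.2]
    exact ⟨this.1, rfl⟩

lemma homDer_lnil (E : Derivation k R[X] R[X]) (hE : Lnil E) (d : ℕ)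
    (h1 : ∀ a, (E (C a)).natDegree ≤ d) (h2 : (E X).natDegree ≤ d + 1) :
    Lnil (homDer (topDer E d) ((E X).coeff (d+1)) d) := by
  intro p
  induction p using Polynomial.induction_on' with
  | add p q hp hq =>
    obtain ⟨m, hm⟩ := hp
    obtain ⟨n, hn⟩ := hq
    refine ⟨max m n, ?_⟩
    rw [iterate_map_add, iter_zero_of_le (le_max_left m n) hm,
      iter_zero_of_le (le_max_right m n) hn, add_zero]
  | monomial i a =>
    obtain ⟨n, hn⟩ := hE (monomial i a)
    refine ⟨n, ?_⟩
    rw [(homDer_iter E d h1 h2 i a n).2, hn]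
    simp

lemma bound_exists [Algebra.FiniteType k R] (E : Derivation k R[X] R[X]) :
    ∃ d, ∀ a, (E (C a)).natDegree ≤ d := by
  obtain ⟨s, hs⟩ := (‹Algebra.FiniteType k R›).out
  refine ⟨s.sup fun a => (E (C a)).natDegree, fun a => ?_⟩
  have : a ∈ Algebra.adjoin k (s : Set R) := by rw [hs]; trivial
  induction this using Algebra.adjoin_induction with
  | mem x hx => exact Finset.le_sup (f := fun a => (E (C a)).natDegree) hx
  | algebraMap r =>
    have : (C (algebraMap k R r)) = algebraMap k R[X] r := rfl
    rw [this, Derivation.map_algebraMap]; simp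
  | add x y _ _ hx hy =>
    rw [map_add, map_add]
    exact natDegree_add_le_of_degree_le hx hy
  | mul x y _ _ hx hy =>
    rw [map_mul, Derivation.leibniz]
    exact natDegree_add_le_of_degree_le ((natDegree_C_mul_le _ _).trans hy)
      ((natDegree_C_mul_le _ _).trans hx)

/-- If `R` has no nonzero locally nilpotent derivation, each one of `R[X]` kills `R`. -/
lemma rigid_kill [Algebra.FiniteType k R] (hR : ∀ δ : Derivation k R R, Lnil δ → ∀ a, δ a = 0)
    (E : Derivation k R[X] R[X]) (hE : Lnil E) (a : R) : E (C a) = 0 := by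
  classical
  have hex : ∃ d, (∀ a, (E (C a)).natDegree ≤ d) ∧ (E X).natDegree ≤ d + 1 := by
    obtain ⟨d, hd⟩ := bound_exists E
    exact ⟨max d (E X).natDegree, fun a => (hd a).trans (le_max_left _ _),
      (le_max_right d _).trans (Nat.le_succ _)⟩
  obtain ⟨h1, h2⟩ := Nat.find_spec hex
  have hmin := fun m => Nat.find_min (m := m) hex
  set d := Nat.find hex
  have hl := homDer_lnil E hE d h1 h2
  set b := (E X).coeff (d+1) with hbdef
  set δ := topDer E d with hδdef
  have hb : b = 0 := by
    have hX : homDer δ b d X = monomial (1+d) b := by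
      rw [← monomial_one_one_eq_X, homDer_monomial]; simp [Lmap]
    have : homDer δ b d X = 0 := by
      apply dvd_self_zero hl
      rw [hX, ← C_mul_X_pow_eq_monomial]
      exact (dvd_pow_self X (by omega)).mul_left _
    rw [hX] at this
    simpa using this
  have hδl : Lnil δ := by
    intro c
    obtain ⟨n, hn⟩ := hl (monomial 0 c)
    refine ⟨n, ?_⟩
    have : ∀ n, (⇑(homDer δ b d))^[n] (monomial 0 c) = monomial (n * d) ((⇑δ)^[n] c) := by
      intro n
      induction n with
      | zero => simp
      | succ n ih =>
        rw [Function.iterate_succ_apply', Function.iterate_succ_apply', ih, homDer_monomial]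
        rw [show (n+1)*d = n * d + d by ring]
        congr 1
        simp [Lmap, hb]
    rw [this] at hn
    simpa using hn
  have hδ := hR δ hδl
  have key : ∀ c, (E (C c)).coeff d = 0 := hδ
  rcases Nat.eq_zero_or_pos d with h0 | h0
  · have := key a
    rw [eq_C_of_natDegree_le_zero (p := E (C a)) (h0 ▸ h1 a)]
    rw [h0] at this
    simp [this]
  · exfalso
    refine hmin (d-1) (by omega) ⟨fun c => ?_, ?_⟩
    · by_contra hlt
      have heq : (E (C c)).natDegree = d := by have := h1 c; omega
      have h3 := key c
      rw [← heq] at h3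
      have : E (C c) = 0 := by simpa using h3
      rw [this] at heq; simp at heq; omega
    · by_contra hlt
      have heq : (E X).natDegree = d + 1 := by omega
      have h3 : (E X).coeff (d+1) = 0 := hb
      rw [← heq] at h3
      have : E X = 0 := by simpa using h3
      rw [this] at heq; simp at heq

end graded

end Canc


namespace Canc

open Polynomial

set_option linter.unusedSectionVars false

section setup

variable {k R : Type} [Field k] [CommRing R] [Algebra k R]

lemma dom_of (φ : R[X] ≃ₐ[k] MvPolynomial (Fin 3) k) : IsDomain R := by
  have : IsDomain R[X] := φ.toMulEquiv.isDomain
  exact (C_injective (R := R)).isDomain (C : R →+* R[X])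

lemma ft_of (φ : R[X] ≃ₐ[k] MvPolynomial (Fin 3) k) : Algebra.FiniteType k R := by
  let ψ : R[X] →ₐ[k] R := (aeval (R := R) (0 : R)).restrictScalars k
  have hs : Function.Surjective (ψ.comp φ.symm.toAlgHom) := by
    intro r
    refine ⟨φ (C r), ?_⟩
    simp [ψ]
  exact Algebra.FiniteType.of_surjective _ hs

lemma charZero_of [CharZero k] [Nontrivial R] : CharZero R :=
  charZero_of_injective_algebraMap (algebraMap k R).injective

lemma ufd_of [IsDomain R] (φ : R[X] ≃ₐ[k] MvPolynomial (Fin 3) k) :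
    UniqueFactorizationMonoid R := by
  have := ft_of φ
  have : IsNoetherianRing R := Algebra.FiniteType.isNoetherianRing k R
  have : UniqueFactorizationMonoid R[X] :=
    φ.toMulEquiv.symm.uniqueFactorizationMonoid inferInstance
  refine { irreducible_iff_prime := fun {p} => ⟨fun hp => ?_, Prime.irreducible⟩ }
  rw [← Polynomial.prime_C_iff]
  apply Irreducible.prime
  refine ⟨fun h => hp.not_isUnit (Polynomial.isUnit_C.mp h), fun {a b} hab => ?_⟩
  have hne : a * b ≠ 0 := by rw [← hab]; simpa using hp.ne_zero
  have hd : a.natDegree + b.natDegree = 0 := by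
    rw [← natDegree_mul (left_ne_zero_of_mul hne) (right_ne_zero_of_mul hne), ← hab, natDegree_C]
  have ha := eq_C_of_natDegree_eq_zero (show a.natDegree = 0 by omega)
  have hb := eq_C_of_natDegree_eq_zero (show b.natDegree = 0 by omega)
  rw [ha, hb, ← map_mul] at hab
  rw [ha, hb, Polynomial.isUnit_C, Polynomial.isUnit_C]
  exact hp.isUnit_or_isUnit (C_injective hab)

lemma trdeg_of [IsDomain R] (φ : R[X] ≃ₐ[k] MvPolynomial (Fin 3) k) :
    Algebra.trdeg k R = 2 := by
  have h1 := trdeg_add_eq k R (A := R[X])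
  rw [φ.trdeg_eq, MvPolynomial.trdeg_of_isDomain, Polynomial.trdeg_of_isDomain] at h1
  simp only [Cardinal.mk_fin, Cardinal.lift_natCast] at h1
  have h2 : Algebra.trdeg k R + 1 = (2 : Cardinal) + 1 := by
    rw [h1]; norm_num
  exact (Cardinal.add_one_inj).mp h2

/-- Degree inherited from the polynomial ring. -/
noncomputable def dg (φ : R[X] ≃ₐ[k] MvPolynomial (Fin 3) k) (a : R) : ℕ := (φ (C a)).totalDegree

/-- A rational point. -/
noncomputable def pt (φ : R[X] ≃ₐ[k] MvPolynomial (Fin 3) k) : R →ₐ[k] k :=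
  (MvPolynomial.aeval (fun _ => (0 : k))).comp (φ.toAlgHom.comp (CAlgHom (R := k) (A := R)))

lemma dg_mul [IsDomain R] (φ : R[X] ≃ₐ[k] MvPolynomial (Fin 3) k) {a b : R} (ha : a ≠ 0)
    (hb : b ≠ 0) : dg φ (a * b) = dg φ a + dg φ b := by
  unfold dg
  rw [map_mul, map_mul, MvPolynomial.totalDegree_mul_of_isDomain] <;> simpa

lemma dg_zero (φ : R[X] ≃ₐ[k] MvPolynomial (Fin 3) k) {a : R} (h : dg φ a = 0) :
    ∃ c, a = algebraMap k R c := by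
  unfold dg at h
  rw [MvPolynomial.totalDegree_eq_zero_iff_eq_C] at h
  refine ⟨MvPolynomial.coeff 0 (φ (C a)), C_injective (φ.injective ?_)⟩
  refine h.trans ?_
  exact (φ.commutes _).symm

lemma dg_sub_const (φ : R[X] ≃ₐ[k] MvPolynomial (Fin 3) k) (a : R) (c : k) :
    dg φ (a - algebraMap k R c) ≤ dg φ a := by
  unfold dg
  have : φ (C (a - algebraMap k R c)) = φ (C a) - MvPolynomial.C c := by
    rw [map_sub, map_sub]
    congr 1
    exact φ.commutes c
  rw [this]
  refine (MvPolynomial.totalDegree_sub _ _).trans ?_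
  simp

lemma const_of_pderiv [CharZero k] (p : MvPolynomial (Fin 3) k)
    (h : ∀ i, MvPolynomial.pderiv i p = 0) : ∃ c, p = MvPolynomial.C c := by
  classical
  refine ⟨p.coeff 0, ?_⟩
  ext m
  rw [MvPolynomial.coeff_C]
  split_ifs with hm
  · rw [hm]
  · obtain ⟨i, hi⟩ : ∃ i, m i ≠ 0 := by
      by_contra hcon
      push Not at hcon
      exact hm (Finsupp.ext fun i => (hcon i).symm)
    have h1 := congrArg (MvPolynomial.coeff (m - Finsupp.single i 1)) (h i)
    rw [MvPolynomial.coeff_pderiv] at h1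
    have h2 : m - Finsupp.single i 1 + Finsupp.single i 1 = m := by
      ext j
      by_cases hj : j = i
      · subst hj; simp; omega
      · simp [Ne.symm hj]
    rw [h2] at h1
    have h3 : ((m i - 1 : ℕ) : k) + 1 ≠ 0 := by
      exact_mod_cast Nat.succ_ne_zero (m i - 1)
    simpa [h3] using h1

lemma pderiv_lnil [CharZero k] (i : Fin 3) :
    Lnil (MvPolynomial.pderiv i : Derivation k (MvPolynomial (Fin 3) k) _) := by
  classical
  intro p
  have hX : ∀ j, ∃ n, (⇑(MvPolynomial.pderiv (R := k) i))^[n + 1] (MvPolynomial.X j) = 0 := by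
    intro j
    refine ⟨1, ?_⟩
    by_cases h : j = i
    · subst h; simp
    · simp [MvPolynomial.pderiv_X_of_ne h]
  suffices h : ∃ n, (⇑(MvPolynomial.pderiv (R := k) i))^[n + 1] p = 0 by
    obtain ⟨n, hn⟩ := h
    exact ⟨_, hn⟩
  induction p using MvPolynomial.induction_on with
  | C a => exact ⟨0, by simp⟩
  | add p q hp hq =>
    obtain ⟨m, hm⟩ := hp
    obtain ⟨n, hn⟩ := hq
    refine ⟨max m n, ?_⟩
    rw [iterate_map_add, iter_zero_of_le (m := m+1) (by simp) hm,
      iter_zero_of_le (m := n+1) (by simp) hn, add_zero]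
  | mul_X p j hp =>
    obtain ⟨m, hm⟩ := hp
    obtain ⟨n, hn⟩ := hX j
    exact ⟨m + n, (iter_mul _ (m+n) m n _ _ rfl hm hn).2⟩

/-- Transport of a derivation along an algebra isomorphism. -/
noncomputable def transp {A B : Type} [CommRing A] [CommRing B] [Algebra k A] [Algebra k B]
    (φ : A ≃ₐ[k] B) (D : Derivation k B B) : Derivation k A A :=
  Derivation.mk' (φ.symm.toLinearMap ∘ₗ D.toLinearMap ∘ₗ φ.toLinearMap) (by intro a b; simp)

lemma transp_apply {A B : Type} [CommRing A] [CommRing B] [Algebra k A] [Algebra k B]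
    (φ : A ≃ₐ[k] B) (D : Derivation k B B) (a : A) : transp φ D a = φ.symm (D (φ a)) := rfl

lemma transp_lnil {A B : Type} [CommRing A] [CommRing B] [Algebra k A] [Algebra k B]
    (φ : A ≃ₐ[k] B) (D : Derivation k B B) (h : Lnil D) : Lnil (transp φ D) := by
  intro a
  obtain ⟨n, hn⟩ := h (φ a)
  refine ⟨n, ?_⟩
  have : ∀ n, (⇑(transp φ D))^[n] a = φ.symm ((⇑D)^[n] (φ a)) := by
    intro n
    induction n with
    | zero => simp
    | succ n ih => rw [Function.iterate_succ_apply', Function.iterate_succ_apply', ih,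
        transp_apply, AlgEquiv.apply_symm_apply]
  rw [this, hn, map_zero]

lemma exists_lnd [CharZero k] [IsDomain R] [CharZero R]
    (φ : R[X] ≃ₐ[k] MvPolynomial (Fin 3) k) :
    ∃ δ : Derivation k R R, Lnil δ ∧ ∃ a, δ a ≠ 0 := by
  by_contra hcon
  push Not at hcon
  have := ft_of φ
  have hk := fun i => rigid_kill hcon _ (transp_lnil φ _ (pderiv_lnil i))
  have hall : ∀ a : R, ∃ c, a = algebraMap k R c := by
    intro a
    obtain ⟨c, hc⟩ := const_of_pderiv (φ (C a)) (fun i => by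
      have := hk i a
      rw [transp_apply] at this
      simpa using this)
    apply dg_zero φ
    unfold dg
    rw [hc]; simp
  have : Algebra.IsAlgebraic k R := ⟨fun a => by
    obtain ⟨c, rfl⟩ := hall a
    exact isAlgebraic_algebraMap c⟩
  have h0 := trdeg_eq_zero (R := k) (A := R)
  rw [trdeg_of φ] at h0
  norm_num at h0

end setup

end Canc


namespace Canc

open Polynomial

set_option linter.unusedSectionVars false

section trd

variable {k B : Type} [Field k] [CommRing B] [IsDomain B] [CharZero B] [Algebra k B]

lemma ker_trdeg {D : Derivation k B B} {a : B} (ha : D a ≠ 0) :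
    Algebra.trdeg k (kerS D) + 1 ≤ Algebra.trdeg k B := by
  rw [← trdeg_add_eq k (kerS D) (A := B)]
  have : Algebra.Transcendental (kerS D) B := ⟨a, transc_of_slice ha⟩
  gcongr
  exact Cardinal.one_le_iff_pos.mpr (trdeg_pos _ _)

lemma quot_trdeg {g : B} (hg : Prime g) :
    Algebra.trdeg k (B ⧸ Ideal.span {g}) + 1 ≤ Algebra.trdeg k B := by
  have hprime : (Ideal.span {g}).IsPrime := (Ideal.span_singleton_prime hg.ne_zero).mpr hg
  have : FaithfulSMul k (B ⧸ Ideal.span {g}) :=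
    (faithfulSMul_iff_algebraMap_injective k _).mpr (algebraMap k _).injective
  obtain ⟨s, hs⟩ := exists_isTranscendenceBasis k (B ⧸ Ideal.span {g})
  rw [← hs.cardinalMk_eq_trdeg]
  have hx := hs.1
  set x : s → B ⧸ Ideal.span {g} := ((↑) : s → B ⧸ Ideal.span {g}) with hxdef
  choose y hy using fun i : s => Ideal.Quotient.mk_surjective (x i)
  let π : B →ₐ[k] B ⧸ Ideal.span {g} := Ideal.Quotient.mkₐ k _
  have hπ : ∀ b, π b = 0 ↔ g ∣ b := by
    intro b
    change Ideal.Quotient.mk _ b = 0 ↔ _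
    rw [Ideal.Quotient.eq_zero_iff_mem, Ideal.mem_span_singleton]
  have hcomp : ∀ p : MvPolynomial s k, π (MvPolynomial.aeval (R := k) y p) =
      MvPolynomial.aeval (R := k) x p := by
    intro p
    have hxy : x = fun i => π (y i) := funext fun i => (hy i).symm
    rw [hxy, ← MvPolynomial.comp_aeval_apply]
  have hyi : AlgebraicIndependent k y := by
    rw [algebraicIndependent_iff]
    intro p hp
    apply (algebraicIndependent_iff.mp hx) p
    rw [← hcomp, hp, map_zero]
  have htr : Transcendental (Algebra.adjoin k (Set.range y)) g := by
    rw [transcendental_iff]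
    intro P hP
    by_contra hne
    obtain ⟨Q, hQ, hnd⟩ := Polynomial.exists_eq_pow_rootMultiplicity_mul_and_not_dvd P hne 0
    rw [map_zero, sub_zero] at hQ hnd
    rw [X_dvd_iff] at hnd
    rw [hQ, map_mul, map_pow, aeval_X] at hP
    have hQ0 := (mul_eq_zero.mp hP).resolve_left (pow_ne_zero _ hg.ne_zero)
    have hdvd : g ∣ ((Q.coeff 0 : Algebra.adjoin k (Set.range y)) : B) := by
      have h1 := Polynomial.divX_mul_X_add Q
      rw [← h1, map_add, map_mul, aeval_X, aeval_C] at hQ0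
      have h2 : ((Q.coeff 0 : Algebra.adjoin k (Set.range y)) : B) = - (aeval g Q.divX * g) :=
        (neg_eq_of_add_eq_zero_right hQ0).symm
      rw [h2]
      exact (dvd_mul_left _ _).neg_right
    apply hnd
    obtain ⟨p, hp⟩ : ((Q.coeff 0 : Algebra.adjoin k (Set.range y)) : B) ∈
        (MvPolynomial.aeval (R := k) y).range := by
      rw [← Algebra.adjoin_range_eq_range_aeval]; exact (Q.coeff 0).2
    have hp' : MvPolynomial.aeval y p = ((Q.coeff 0 : Algebra.adjoin k (Set.range y)) : B) := hp
    rw [← hp', ← hπ, hcomp] at hdvd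
    have := (algebraicIndependent_iff.mp hx) p hdvd
    apply Subtype.ext
    rw [← hp', this]; simp
  have hopt := (hyi.option_iff_transcendental g).mpr htr
  have := hopt.cardinalMk_le_trdeg
  rwa [Cardinal.mk_option] at this

lemma quot_alg {g : B} (hg : Prime g) (hz : Algebra.trdeg k (B ⧸ Ideal.span {g}) = 0) :
    Algebra.IsAlgebraic k (B ⧸ Ideal.span {g}) := by
  have hprime : (Ideal.span {g}).IsPrime := (Ideal.span_singleton_prime hg.ne_zero).mpr hg
  have : FaithfulSMul k (B ⧸ Ideal.span {g}) :=
    (faithfulSMul_iff_algebraMap_injective k _).mpr (algebraMap k _).injective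
  exact trdeg_eq_zero_iff.mp hz

end trd

section kernel

variable {k R : Type} [Field k] [CommRing R] [Algebra k R]

lemma exists_prime_pt [IsDomain R] [UniqueFactorizationMonoid R] (ε : R →ₐ[k] k) (a : R) :
    a ≠ 0 → ε a = 0 → ∃ p, Prime p ∧ p ∣ a ∧ ε p = 0 := by
  induction a using UniqueFactorizationMonoid.induction_on_prime with
  | h₁ => intro h; exact absurd rfl h
  | h₂ x hx => intro _ h; exact absurd h (hx.map ε).ne_zero
  | h₃ a p ha hp ih =>
    intro _ h
    rw [map_mul] at h
    rcases mul_eq_zero.mp h with h | h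
    · exact ⟨p, hp, dvd_mul_right _ _, h⟩
    · obtain ⟨q, hq, hqd, hq0⟩ := ih ha h
      exact ⟨q, hq, hqd.mul_left _, hq0⟩

lemma exists_nonconst [CharZero k] [IsDomain R] [CharZero R]
    (h2 : Algebra.trdeg k R = 2)
    {D : Derivation k R R} (hD : Lnil D) (h0 : ∃ a, D a ≠ 0) :
    ∃ c, D c = 0 ∧ ∀ u, c ≠ algebraMap k R u := by
  by_contra hcon
  push Not at hcon
  obtain ⟨a, ha, ha'⟩ := exists_local_slice hD h0
  obtain ⟨u, hu⟩ := hcon _ ha'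
  have hu0 : u ≠ 0 := by rintro rfl; simp [hu] at ha
  have hs : D (u⁻¹ • a) = 1 := by
    rw [Derivation.map_smul, hu, Algebra.smul_def, ← map_mul, inv_mul_cancel₀ hu0, map_one]
  have hsurj : Function.Surjective (aeval (R := kerS D) (u⁻¹ • a)) := slice_surj hD hs
  have h1 : Algebra.trdeg (kerS D) R ≤ 1 := by
    rw [← Polynomial.trdeg_of_isDomain (R := kerS D)]
    exact trdeg_le_of_surjective _ hsurj
  have : Algebra.IsAlgebraic k (kerS D) := ⟨fun c => by
    obtain ⟨v, hv⟩ := hcon c.1 c.2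
    have : c = algebraMap k (kerS D) v := Subtype.ext hv
    rw [this]
    exact isAlgebraic_algebraMap v⟩
  have h3 := trdeg_add_eq k (kerS D) (A := R)
  rw [trdeg_eq_zero, h2, zero_add] at h3
  rw [h3] at h1
  norm_num at h1

lemma ker_eq [CharZero k] [IsDomain R] [CharZero R]
    (φ : R[X] ≃ₐ[k] MvPolynomial (Fin 3) k)
    {D : Derivation k R R} (hD : Lnil D) (h0 : ∃ a, D a ≠ 0) :
    ∃ f, Prime f ∧ D f = 0 ∧ ∀ c, D c = 0 → ∃ P : k[X], c = aeval f P := by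
  have := ufd_of φ
  have htr := trdeg_of φ
  obtain ⟨c₀, hc₀, hnc⟩ := exists_nonconst htr hD h0
  let ε := pt φ
  have hε : ∀ u, ε (algebraMap k R u) = u := fun u => ε.commutes u
  have hne : c₀ - algebraMap k R (ε c₀) ≠ 0 := fun h => hnc _ (sub_eq_zero.mp h)
  have hker : D (c₀ - algebraMap k R (ε c₀)) = 0 := by simp [hc₀]
  obtain ⟨f, hf, ⟨w, hw⟩, hfε⟩ := exists_prime_pt ε _ hne (by rw [map_sub, hε, sub_self])
  have hDf : D f = 0 := by
    rw [hw] at hne hker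
    exact (fact_closed hD hne hker).1
  refine ⟨f, hf, hDf, ?_⟩
  -- divisibility stays in the kernel
  have hdiv : ∀ c d, D c = 0 → c = f * d → D d = 0 := by
    intro c d hc hcd
    rw [hcd, Derivation.leibniz, hDf] at hc
    simpa [hf.ne_zero] using hc
  have hprime : Prime (⟨f, hDf⟩ : kerS D) := by
    refine ⟨fun h => hf.ne_zero (congrArg Subtype.val h),
      fun h => hf.not_isUnit (h.map (kerS D).val), ?_⟩
    rintro ⟨a, ha⟩ ⟨b, hb⟩ ⟨⟨c, hc⟩, habc⟩
    have h1 : a * b = f * c := congrArg Subtype.val habc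
    rcases hf.dvd_or_dvd ⟨c, h1⟩ with ⟨d, hd⟩ | ⟨d, hd⟩
    · exact Or.inl ⟨⟨d, hdiv _ _ ha hd⟩, Subtype.ext hd⟩
    · exact Or.inr ⟨⟨d, hdiv _ _ hb hd⟩, Subtype.ext hd⟩
  have hq := quot_trdeg (k := k) hprime
  obtain ⟨a₀, ha₀⟩ := h0
  have hkt := ker_trdeg ha₀
  have hz : Algebra.trdeg k (kerS D ⧸ Ideal.span {(⟨f, hDf⟩ : kerS D)}) = 0 := by
    have h2 : Algebra.trdeg k (kerS D ⧸ Ideal.span {(⟨f, hDf⟩ : kerS D)}) + 1 + 1 ≤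
        (0 : Cardinal) + 1 + 1 := by
      calc _ ≤ Algebra.trdeg k (kerS D) + 1 := by gcongr
        _ ≤ _ := hkt
        _ = _ := by rw [htr]; norm_num
    rw [Cardinal.add_one_le_add_one_iff, Cardinal.add_one_le_add_one_iff] at h2
    exact le_antisymm h2 zero_le
  have halg : Algebra.IsAlgebraic k (kerS D ⧸ Ideal.span {(⟨f, hDf⟩ : kerS D)}) :=
    quot_alg hprime hz
  have hfd : ∀ c, D c = 0 → ε c = 0 → f ∣ c := by
    intro c hc hcε
    obtain ⟨q, hq0, hq⟩ := halg.isAlgebraic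
      (Ideal.Quotient.mkₐ k (Ideal.span {(⟨f, hDf⟩ : kerS D)}) ⟨c, hc⟩)
    rw [aeval_algHom_apply, Ideal.Quotient.mkₐ_eq_mk, Ideal.Quotient.eq_zero_iff_mem,
      Ideal.mem_span_singleton] at hq
    have hq' : f ∣ aeval c q := by
      have := (map_dvd (kerS D).val hq)
      rw [← aeval_algHom_apply] at this
      exact this
    obtain ⟨Q, hQ, hnd⟩ := Polynomial.exists_eq_pow_rootMultiplicity_mul_and_not_dvd q hq0 0
    rw [map_zero, sub_zero] at hQ hnd
    rw [X_dvd_iff] at hnd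
    rw [hQ, map_mul, map_pow, aeval_X] at hq'
    rcases hf.dvd_or_dvd hq' with h | h
    · exact hf.dvd_of_dvd_pow h
    · exfalso
      have := map_dvd ε h
      rw [hfε, zero_dvd_iff, ← aeval_algHom_apply, hcε, ← coeff_zero_eq_aeval_zero] at this
      exact hnd this
  have hdf : 1 ≤ dg φ f := by
    by_contra hlt
    obtain ⟨u, hu⟩ := dg_zero φ (a := f) (by omega)
    have hu0 : u = 0 := by rw [← hε u, ← hu, hfε]
    exact hf.ne_zero (by rw [hu, hu0, map_zero])
  intro c
  induction hn : dg φ c using Nat.strong_induction_on generalizing c with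
  | _ n ih =>
    intro hc
    by_cases hcc : c - algebraMap k R (ε c) = 0
    · exact ⟨C (ε c), by rw [aeval_C]; exact sub_eq_zero.mp hcc⟩
    have hDc : D (c - algebraMap k R (ε c)) = 0 := by simp [hc]
    obtain ⟨d, hd⟩ := hfd _ hDc (by rw [map_sub, hε, sub_self])
    have hd0 : d ≠ 0 := by rintro rfl; rw [mul_zero] at hd; exact hcc hd
    have h1 := dg_sub_const φ c (ε c)
    rw [hd, dg_mul φ hf.ne_zero hd0] at h1
    obtain ⟨P, hP⟩ := ih (dg φ d) (by omega) d rfl (hdiv _ _ hDc hd)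
    refine ⟨X * P + C (ε c), ?_⟩
    rw [map_add, map_mul, aeval_X, aeval_C, ← hP, ← hd]
    ring

lemma transc_of_prime [IsDomain R] {f : R} (hf : Prime f) : Transcendental k f := by
  intro h
  exact hf.not_isUnit (h.isIntegral.isUnit hf.ne_zero)

end kernel

end Canc


namespace Canc

open Polynomial

set_option linter.unusedSectionVars false

section div

variable {k B : Type} [Field k] [CommRing B] [IsDomain B] [CharZero B] [Algebra k B]

lemma div_der {D : Derivation k B B} (hD : Lnil D) {g : B} (hg : D g = 0) (hg0 : g ≠ 0)
    (hdiv : ∀ a, g ∣ D a) :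
    ∃ D' : Derivation k B B, Lnil D' ∧ ∀ a, D a = g * D' a := by
  choose d hd using hdiv
  have hc : ∀ {x y : B}, g * x = g * y → x = y := fun h => mul_left_cancel₀ hg0 h
  let L : B →ₗ[k] B :=
    { toFun := d
      map_add' := fun x y => hc (by rw [← hd, map_add, hd, hd, mul_add])
      map_smul' := fun c x => hc (by
        rw [← hd, Derivation.map_smul, hd, RingHom.id_apply, mul_smul_comm]) }
  let D' : Derivation k B B := Derivation.mk' L (fun a b => hc (by
    change g * d (a * b) = g * (a * d b + b * d a)
    rw [← hd, Derivation.leibniz, hd, hd a]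
    simp only [smul_eq_mul]; ring))
  have hD' : ∀ a, D a = g * D' a := fun a => hd a
  refine ⟨D', ?_, hD'⟩
  have hit : ∀ n a, (⇑D)^[n] a = g ^ n * (⇑D')^[n] a := by
    intro n
    induction n with
    | zero => intro a; simp
    | succ n ih =>
      intro a
      rw [Function.iterate_succ_apply, hD', iter_const hg, ih, Function.iterate_succ_apply]
      ring
  intro a
  obtain ⟨n, hn⟩ := hD a
  refine ⟨n, ?_⟩
  rw [hit] at hn
  exact (mul_eq_zero.mp hn).resolve_left (pow_ne_zero _ hg0)

end div

section lemP

variable {F S : Type} [Field F] [IsAlgClosed F] [CharZero F] [CommRing S] [IsDomain S] [CharZero S]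
  [Algebra F S]

lemma trans_inj {f : S} (hf : Transcendental F f) {P Q : F[X]} (h : aeval f P = aeval f Q) :
    P = Q := by
  rw [transcendental_iff] at hf
  exact sub_eq_zero.mp (hf _ (by rw [map_sub, h, sub_self]))

lemma prime_sub [UniqueFactorizationMonoid S] {f : S} (hf : Transcendental F f)
    {D : Derivation F S S} (hD : Lnil D) (hDf : D f = 0)
    (hker : ∀ c, D c = 0 → ∃ P : F[X], c = aeval f P) (l : F) :
    Prime (aeval f (X - C l)) := by
  rw [← irreducible_iff_prime]
  have hne : aeval f (X - C l) ≠ 0 := by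
    intro h
    exact X_sub_C_ne_zero l (trans_inj hf (by rw [h, map_zero]))
  have hD0 : D (aeval f (X - C l)) = 0 := by simp [hDf]
  refine ⟨?_, ?_⟩
  · rintro hu
    obtain ⟨v, hv⟩ := hu.exists_right_inv
    have hDv := (fact_closed hD (by rw [hv]; exact one_ne_zero) (by rw [hv]; simp)).2
    obtain ⟨P, rfl⟩ := hker _ hDv
    rw [← map_mul, ← map_one (aeval (R := F) f)] at hv
    exact not_isUnit_X_sub_C l (IsUnit.of_mul_eq_one _ (trans_inj hf hv))
  · intro a b hab
    have := fact_closed hD (hab ▸ hne) (hab ▸ hD0)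
    obtain ⟨P, rfl⟩ := hker _ this.1
    obtain ⟨Q, rfl⟩ := hker _ this.2
    rw [← map_mul] at hab
    rcases (irreducible_X_sub_C l).isUnit_or_isUnit (trans_inj hf hab) with h | h
    · exact Or.inl (h.map (aeval (R := F) f))
    · exact Or.inr (h.map (aeval (R := F) f))

lemma quot_const_aux {Q : Type} [CommRing Q] [IsDomain Q] [CharZero Q] [Algebra F Q]
    (π : S →ₐ[F] Q) (hsurj : Function.Surjective π) (htr : Algebra.trdeg F Q + 1 ≤ 2)
    {D : Derivation F S S} (hd : ∀ x, π x = 0 → π (D x) = 0)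
    {a : S} (ha : π (D a) ≠ 0) {r : S} (hr : π (D r) = 0) :
    ∃ m : F, π (r - algebraMap F S m) = 0 := by
  let E : Derivation F Q Q := Derivation.liftOfSurjective hsurj hd
  have hE : ∀ x, E (π x) = π (D x) := Derivation.liftOfSurjective_apply hsurj hd
  have hkt := ker_trdeg (D := E) (a := π a) (by rw [hE]; exact ha)
  have hz : Algebra.trdeg F (kerS E) = 0 := by
    have h2 : Algebra.trdeg F (kerS E) + 1 + 1 ≤ (0 : Cardinal) + 1 + 1 := by
      calc _ ≤ Algebra.trdeg F Q + 1 := by gcongr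
        _ ≤ 2 := htr
        _ = _ := by norm_num
    rw [Cardinal.add_one_le_add_one_iff, Cardinal.add_one_le_add_one_iff] at h2
    exact le_antisymm h2 zero_le
  have halg : Algebra.IsAlgebraic F (kerS E) := trdeg_eq_zero_iff.mp hz
  have hinteg : Algebra.IsIntegral F (kerS E) := Algebra.isAlgebraic_iff_isIntegral.mp halg
  obtain ⟨m, hm⟩ := (IsAlgClosed.algebraMap_bijective_of_isIntegral (k := F)
    (K := kerS E)).2 ⟨π r, by rw [mem_kerS, hE, hr]⟩
  refine ⟨m, ?_⟩
  have h3 : algebraMap F Q m = π r := congrArg Subtype.val hm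
  rw [map_sub, AlgHom.commutes, h3, sub_self]

/-- In the quotient by a constant prime not dividing the derivation, constants are scalars. -/
lemma quot_const (htr : Algebra.trdeg F S = 2) {g : S} (hg : Prime g)
    {D : Derivation F S S} (hDg : D g = 0) {a : S} (ha : ¬ g ∣ D a) {r : S} (hr : g ∣ D r) :
    ∃ m : F, g ∣ r - algebraMap F S m := by
  have hprime : (Ideal.span {g}).IsPrime := (Ideal.span_singleton_prime hg.ne_zero).mpr hg
  have hq := quot_trdeg (k := F) hg
  rw [htr] at hq
  have hmk : ∀ b, Ideal.Quotient.mkₐ F (Ideal.span {g}) b = 0 ↔ g ∣ b := by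
    intro b
    rw [Ideal.Quotient.mkₐ_eq_mk, Ideal.Quotient.eq_zero_iff_mem, Ideal.mem_span_singleton]
  have hcz : CharZero (S ⧸ Ideal.span {g}) := charZero_of (k := F)
  obtain ⟨m, hm⟩ := quot_const_aux (Ideal.Quotient.mkₐ F (Ideal.span {g}))
    (Ideal.Quotient.mkₐ_surjective F (Ideal.span {g})) hq (D := D)
    (by
      intro x hx
      rw [hmk] at hx ⊢
      obtain ⟨y, rfl⟩ := hx
      rw [Derivation.leibniz, hDg]
      simp) (a := a) (by rwa [Ne, hmk]) (r := r) (by rwa [hmk])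
  exact ⟨m, (hmk _).mp hm⟩

lemma lemP [UniqueFactorizationMonoid S] (htr : Algebra.trdeg F S = 2)
    {f : S} (hf : Transcendental F f) (n : ℕ) :
    ∀ (D : Derivation F S S) (r : S) (h : F[X]), h.natDegree = n → Lnil D → D f = 0 →
      (∀ c, D c = 0 → ∃ P : F[X], c = aeval f P) → h ≠ 0 → D r = aeval f h →
      ∃ (r' : S) (h' : F[X]), Monic h' ∧ D r' = aeval f h' ∧ ∀ a, aeval f h' ∣ D a := by
  induction n with
  | zero =>
    intro D r h hn hD hDf hker h0 hr
    obtain ⟨u, rfl⟩ := natDegree_eq_zero.mp hn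
    have hu : u ≠ 0 := by rintro rfl; simp at h0
    refine ⟨u⁻¹ • r, 1, monic_one, ?_, fun a => by rw [map_one]; exact one_dvd _⟩
    rw [Derivation.map_smul, hr, aeval_C, Algebra.smul_def, ← map_mul, inv_mul_cancel₀ hu,
      map_one, map_one]
  | succ n ih =>
    intro D r h hn hD hDf hker h0 hr
    obtain ⟨l, hl⟩ := IsAlgClosed.exists_root h (by
      intro hd
      rw [degree_eq_natDegree h0, hn] at hd
      norm_cast at hd)
    obtain ⟨h1, rfl⟩ := dvd_iff_isRoot.mpr hl
    have h10 : h1 ≠ 0 := right_ne_zero_of_mul h0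
    have hdeg : h1.natDegree = n := by
      rw [natDegree_mul (X_sub_C_ne_zero l) h10, natDegree_X_sub_C] at hn
      omega
    have hp := prime_sub hf hD hDf hker l
    have hDp : D (aeval f (X - C l)) = 0 := by simp [hDf]
    by_cases hall : ∀ a, aeval f (X - C l) ∣ D a
    · obtain ⟨D', hD'l, hD'⟩ := div_der hD hDp hp.ne_zero hall
      have hz : ∀ c, D' c = 0 ↔ D c = 0 := by
        intro c; rw [hD', mul_eq_zero, or_iff_right hp.ne_zero]
      obtain ⟨r', h', hm, hr', hdv⟩ := ih D' r h1 hdeg hD'l ((hz _).mpr hDf)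
        (fun c hc => hker c ((hz c).mp hc)) h10
        (mul_left_cancel₀ hp.ne_zero (by rw [← hD', hr, map_mul]))
      refine ⟨r', (X - C l) * h', (monic_X_sub_C l).mul hm, ?_, fun a => ?_⟩
      · rw [hD', hr', map_mul]
      · rw [hD', map_mul]; exact mul_dvd_mul_left _ (hdv a)
    · push Not at hall
      obtain ⟨a, ha⟩ := hall
      obtain ⟨m, r1, hr1⟩ := quot_const htr hp hDp ha (r := r)
        (by rw [hr, map_mul]; exact dvd_mul_right _ _)
      apply ih D r1 h1 hdeg hD hDf hker h10
      apply mul_left_cancel₀ hp.ne_zero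
      rw [← map_mul, ← hr]
      have h5 := congrArg D hr1
      rw [map_sub, Derivation.map_algebraMap, sub_zero, Derivation.leibniz, hDp] at h5
      rw [h5]; simp

lemma lemP' [UniqueFactorizationMonoid S] (htr : Algebra.trdeg F S = 2)
    {f : S} (hf : Transcendental F f) {D : Derivation F S S} (hD : Lnil D) (h0 : ∃ a, D a ≠ 0)
    (hDf : D f = 0) (hker : ∀ c, D c = 0 → ∃ P : F[X], c = aeval f P) :
    ∃ (r' : S) (h' : F[X]), Monic h' ∧ D r' = aeval f h' ∧ ∀ a, aeval f h' ∣ D a := by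
  obtain ⟨a, ha, ha'⟩ := exists_local_slice hD h0
  obtain ⟨P, hP⟩ := hker _ ha'
  exact lemP htr hf _ D a P rfl hD hDf hker (by rintro rfl; simp [hP] at ha) hP

end lemP

end Canc


namespace Canc

open Polynomial TensorProduct

set_option linter.unusedSectionVars false

section bc

variable {k F R : Type} [Field k] [Field F] [Algebra k F] [CommRing R] [Algebra k R]

noncomputable def phiF (φ : R[X] ≃ₐ[k] MvPolynomial (Fin 3) k) :
    (F ⊗[k] R)[X] ≃ₐ[F] MvPolynomial (Fin 3) F :=
  let e1 : (F ⊗[k] R)[X] ≃ₐ[F] (F ⊗[k] R) ⊗[k] k[X] :=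
    (polyEquivTensor' k (F ⊗[k] R)).restrictScalars F
  let e2 : (F ⊗[k] R) ⊗[k] k[X] ≃ₐ[F] F ⊗[k] (R ⊗[k] k[X]) :=
    Algebra.TensorProduct.assoc k k F F R k[X]
  let e3 : F ⊗[k] (R ⊗[k] k[X]) ≃ₐ[F] F ⊗[k] (MvPolynomial (Fin 3) k) :=
    Algebra.TensorProduct.congr AlgEquiv.refl ((polyEquivTensor k R).symm.trans φ)
  let e4 : F ⊗[k] (MvPolynomial (Fin 3) k) ≃ₐ[F] MvPolynomial (Fin 3) F :=
    MvPolynomial.algebraTensorAlgEquiv k F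
  e1.trans (e2.trans (e3.trans e4))

/-- Base change of a derivation. -/
noncomputable def derF (D : Derivation k R R) : Derivation F (F ⊗[k] R) (F ⊗[k] R) :=
  Derivation.mk' (LinearMap.baseChange F (D : R →ₗ[k] R)) (by
    intro a b
    induction a using TensorProduct.induction_on with
    | zero => simp
    | add x y hx hy => rw [add_mul, map_add, hx, hy, map_add, add_smul, smul_add]; abel
    | tmul p r =>
      induction b using TensorProduct.induction_on with
      | zero => simp
      | add x y hx hy => rw [mul_add, map_add, hx, hy, map_add, add_smul, smul_add]; abel
      | tmul q s =>
        simp [Algebra.TensorProduct.tmul_mul_tmul, TensorProduct.tmul_add, mul_comm])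

lemma derF_tmul (D : Derivation k R R) (p : F) (r : R) : derF D (p ⊗ₜ[k] r) = p ⊗ₜ[k] D r := by
  simp [derF]

lemma derF_iter (D : Derivation k R R) (p : F) (r : R) (n : ℕ) :
    (⇑(derF (F := F) D))^[n] (p ⊗ₜ[k] r) = p ⊗ₜ[k] (⇑D)^[n] r := by
  induction n generalizing r with
  | zero => rfl
  | succ n ih => rw [Function.iterate_succ_apply, derF_tmul, ih, Function.iterate_succ_apply]

lemma derF_lnil [IsDomain (F ⊗[k] R)] [CharZero (F ⊗[k] R)]
    {D : Derivation k R R} (hD : Lnil D) : Lnil (derF (F := F) D) := by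
  intro a
  induction a using TensorProduct.induction_on with
  | zero => exact ⟨0, rfl⟩
  | tmul p r =>
    obtain ⟨n, hn⟩ := hD r
    exact ⟨n, by rw [derF_iter, hn, tmul_zero]⟩
  | add x y hx hy =>
    obtain ⟨m, hm⟩ := hx
    obtain ⟨n, hn⟩ := hy
    refine ⟨max m n, ?_⟩
    rw [iterate_map_add, iter_zero_of_le (le_max_left _ _) hm,
      iter_zero_of_le (le_max_right _ _) hn, add_zero]

/-- The coordinate map attached to a functional. -/
noncomputable def cm (l : F →ₗ[k] k) : F ⊗[k] R →ₗ[k] R :=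
  (TensorProduct.lid k R).toLinearMap ∘ₗ LinearMap.rTensor R l

lemma cm_tmul (l : F →ₗ[k] k) (p : F) (r : R) : cm l (p ⊗ₜ[k] r) = l p • r := by
  simp [cm]

lemma cm_mul (l : F →ₗ[k] k) (a : R) (w : F ⊗[k] R) :
    cm l ((1 ⊗ₜ[k] a) * w) = a * cm l w := by
  induction w using TensorProduct.induction_on with
  | zero => simp
  | tmul p r => rw [Algebra.TensorProduct.tmul_mul_tmul, cm_tmul, cm_tmul, one_mul, mul_smul_comm]
  | add x y hx hy => rw [mul_add, map_add, hx, hy, map_add, mul_add]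

lemma cm_der (l : F →ₗ[k] k) (D : Derivation k R R) (w : F ⊗[k] R) :
    cm l (derF D w) = D (cm l w) := by
  induction w using TensorProduct.induction_on with
  | zero => simp
  | tmul p r => rw [derF_tmul, cm_tmul, cm_tmul, Derivation.map_smul]
  | add x y hx hy => rw [map_add, map_add, hx, hy, map_add, map_add]

/-- Apply a functional to the coefficients of a polynomial. -/
noncomputable def pc (l : F →ₗ[k] k) (P : F[X]) : k[X] :=
  ∑ i ∈ Finset.range (P.natDegree + 1), C (l (P.coeff i)) * X ^ i

lemma pc_coeff (l : F →ₗ[k] k) (P : F[X]) (n : ℕ) : (pc l P).coeff n = l (P.coeff n) := by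
  rw [pc, finsetSum_coeff]
  simp only [coeff_C_mul_X_pow]
  rw [Finset.sum_ite_eq]
  split_ifs with h
  · rfl
  · rw [coeff_eq_zero_of_natDegree_lt (by simpa using h), map_zero]

lemma cm_aeval (l : F →ₗ[k] k) (f : R) (P : F[X]) :
    cm l (aeval ((1 : F) ⊗ₜ[k] f) P) = aeval f (pc l P) := by
  conv_lhs => rw [aeval_eq_sum_range]
  rw [pc, map_sum, map_sum]
  refine Finset.sum_congr rfl fun i _ => ?_
  rw [Algebra.TensorProduct.tmul_pow, one_pow, TensorProduct.smul_tmul', smul_eq_mul, mul_one,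
    cm_tmul, map_mul, aeval_C, map_pow, aeval_X, Algebra.smul_def]

/-- Expansion along a basis. -/
lemma cm_expand {ι : Type} (b : Module.Basis ι k F) (w : F ⊗[k] R) :
    ∃ s : Finset ι, w = ∑ i ∈ s, b i ⊗ₜ[k] cm (b.coord i) w := by
  classical
  suffices h : ∃ s : Finset ι, ∀ t, s ⊆ t → w = ∑ i ∈ t, b i ⊗ₜ[k] cm (b.coord i) w by
    obtain ⟨s, hs⟩ := h
    exact ⟨s, hs s subset_rfl⟩
  induction w using TensorProduct.induction_on with
  | zero => exact ⟨∅, fun t _ => by simp⟩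
  | tmul p r =>
    refine ⟨(b.repr p).support, fun t ht => ?_⟩
    simp only [cm_tmul, TensorProduct.tmul_smul, TensorProduct.smul_tmul', ← TensorProduct.sum_tmul]
    congr 1
    conv_lhs => rw [← b.linearCombination_repr p, Finsupp.linearCombination_apply, Finsupp.sum]
    refine Finset.sum_subset ht fun i _ hi => ?_
    rw [Finsupp.notMem_support_iff.mp hi, zero_smul]
  | add x y hx hy =>
    obtain ⟨s, hs⟩ := hx
    obtain ⟨t, ht⟩ := hy
    refine ⟨s ∪ t, fun u hu => ?_⟩
    simp only [map_add, TensorProduct.tmul_add, Finset.sum_add_distrib]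
    rw [← hs u (Finset.union_subset_left hu), ← ht u (Finset.union_subset_right hu)]

lemma kerF {D : Derivation k R R} {f : R} (hker : ∀ c, D c = 0 → ∃ P : k[X], c = aeval f P)
    (w : F ⊗[k] R) (hw : derF D w = 0) : ∃ P : F[X], w = aeval ((1 : F) ⊗ₜ[k] f) P := by
  let b := Module.Basis.ofVectorSpace k F
  obtain ⟨s, hs⟩ := cm_expand b w
  have h1 : ∀ i, ∃ P : k[X], cm (b.coord i) w = aeval f P := fun i =>
    hker _ (by rw [← cm_der, hw, map_zero])
  choose P hP using h1
  refine ⟨∑ i ∈ s, C (b i) * (P i).map (algebraMap k F), ?_⟩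
  conv_lhs => rw [hs]
  rw [map_sum]
  refine Finset.sum_congr rfl fun i _ => ?_
  have h2 : aeval ((1 : F) ⊗ₜ[k] f) (P i) = (1 : F) ⊗ₜ[k] aeval f (P i) :=
    aeval_algHom_apply (Algebra.TensorProduct.includeRight : R →ₐ[k] F ⊗[k] R) f (P i)
  rw [map_mul, aeval_C, aeval_map_algebraMap, hP, h2, Algebra.TensorProduct.algebraMap_apply,
    Algebra.TensorProduct.tmul_mul_tmul]
  simp

lemma transcF {f : R} (hf : Transcendental k f) : Transcendental F ((1 : F) ⊗ₜ[k] f) := by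
  let b := Module.Basis.ofVectorSpace k F
  rw [transcendental_iff] at hf ⊢
  intro P hP
  ext n
  apply b.ext_elem
  intro i
  have h := cm_aeval (b.coord i) f P
  rw [hP, map_zero] at h
  have h2 := hf _ h.symm
  have h3 := pc_coeff (b.coord i) P n
  rw [h2, coeff_zero] at h3
  simpa using h3.symm

end bc

end Canc


namespace Canc

open Polynomial TensorProduct

set_option linter.unusedSectionVars false

section canc

variable {k R : Type} [Field k] [CharZero k] [CommRing R] [Algebra k R]

lemma aeval_der_zero {B : Type} [CommRing B] [Algebra k B] {D : Derivation k B B} {f : B}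
    (hf : D f = 0) (P : k[X]) : D (aeval f P) = 0 := by
  induction P using Polynomial.induction_on' with
  | add p q hp hq => rw [map_add, map_add, hp, hq, add_zero]
  | monomial n c => simp [aeval_monomial, hf]

lemma descent [IsDomain R] [CharZero R] {F : Type} [Field F] [Algebra k F]
    [IsDomain (F ⊗[k] R)] [CharZero (F ⊗[k] R)] {f : R} (hf : Transcendental k f)
    {D : Derivation k R R} (hDf : D f = 0)
    (hker : ∀ c, D c = 0 → ∃ P : k[X], c = aeval f P) {r' : F ⊗[k] R} {h : F[X]} (hm : Monic h)
    (hr : derF D r' = aeval ((1 : F) ⊗ₜ[k] f) h)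
    (hdiv : ∀ a, aeval ((1 : F) ⊗ₜ[k] f) h ∣ derF D a) :
    ∃ (r : R) (p : k[X]), p ≠ 0 ∧ D r = aeval f p ∧ ∀ a, aeval f p ∣ D a := by
  have hcF : CharZero F := charZero_of (k := k)
  have hfF : Transcendental F ((1 : F) ⊗ₜ[k] f) := transcF hf
  have hDF : derF D ((1 : F) ⊗ₜ[k] f) = 0 := by rw [derF_tmul, hDf, tmul_zero]
  obtain ⟨l, hl⟩ := LinearMap.exists_leftInverse_of_injective (Algebra.linearMap k F)
    (LinearMap.ker_eq_bot.mpr (algebraMap k F).injective)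
  have hl1 : l 1 = 1 := by
    have := LinearMap.congr_fun hl 1
    simpa using this
  have hpr : D (cm l r') = aeval f (pc l h) := by rw [← cm_der, hr, cm_aeval]
  have hle : (pc l h).natDegree ≤ h.natDegree := natDegree_le_iff_coeff_eq_zero.mpr fun n hn => by
    rw [pc_coeff, coeff_eq_zero_of_natDegree_lt hn, map_zero]
  have hpm : Monic (pc l h) := monic_of_natDegree_le_of_coeff_eq_one _ hle
    (by rw [pc_coeff, hm.coeff_natDegree, hl1])
  have hne : aeval ((1 : F) ⊗ₜ[k] f) h ≠ 0 := fun h0 => hm.ne_zero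
    (transcendental_iff.mp hfF _ h0)
  have hmap : ∀ P : k[X], aeval ((1 : F) ⊗ₜ[k] f) (P.map (algebraMap k F)) =
      (1 : F) ⊗ₜ[k] aeval f P := fun P => by
    rw [aeval_map_algebraMap]
    exact aeval_algHom_apply (Algebra.TensorProduct.includeRight : R →ₐ[k] F ⊗[k] R) f P
  obtain ⟨w, hw⟩ := hdiv ((1 : F) ⊗ₜ[k] cm l r')
  have hDw : derF D w = 0 := by
    have h1 := congrArg (derF D) hw
    rw [derF_tmul, hpr, derF_tmul, aeval_der_zero hDf, tmul_zero, Derivation.leibniz,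
      aeval_der_zero hDF, smul_zero, add_zero, smul_eq_mul] at h1
    exact (mul_eq_zero.mp h1.symm).resolve_left hne
  obtain ⟨q, rfl⟩ := kerF hker w hDw
  rw [derF_tmul, hpr, ← hmap, ← map_mul] at hw
  have hpq : (pc l h).map (algebraMap k F) = h * q := by
    have := transcendental_iff.mp hfF ((pc l h).map (algebraMap k F) - h * q)
      (by rw [map_sub, hw, sub_self])
    exact sub_eq_zero.mp this
  have heq : (pc l h).map (algebraMap k F) = h :=
    eq_of_monic_of_dvd_of_natDegree_le hm (hpm.map _) ⟨q, hpq⟩ (by simpa using hle)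
  refine ⟨cm l r', pc l h, hpm.ne_zero, hpr, fun a => ?_⟩
  obtain ⟨w, hw⟩ := hdiv ((1 : F) ⊗ₜ[k] a)
  rw [← heq, hmap, derF_tmul] at hw
  have := congrArg (cm l) hw
  rw [cm_mul, cm_tmul, hl1, one_smul] at this
  exact ⟨_, this⟩

theorem cancellation (φ : R[X] ≃ₐ[k] MvPolynomial (Fin 3) k) :
    ∃ f g : R, Algebra.adjoin k {f, g} = ⊤ := by
  have := dom_of φ
  have : CharZero R := charZero_of (k := k)
  obtain ⟨D, hD, h0⟩ := exists_lnd φ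
  obtain ⟨f, hfp, hDf, hker⟩ := ker_eq φ hD h0
  have hf : Transcendental k f := transc_of_prime hfp
  let F := AlgebraicClosure k
  let ψ : (F ⊗[k] R)[X] ≃ₐ[F] MvPolynomial (Fin 3) F := phiF φ
  have := dom_of ψ
  have : CharZero (F ⊗[k] R) := charZero_of (k := F)
  have := ufd_of ψ
  have htr := trdeg_of ψ
  obtain ⟨r', h', hm, hr', hdv⟩ := lemP' htr (transcF (F := F) hf) (derF_lnil (F := F) hD)
    (by
      obtain ⟨a, ha⟩ := h0
      refine ⟨(1 : F) ⊗ₜ[k] a, fun h => ha ?_⟩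
      rw [derF_tmul] at h
      have := Algebra.TensorProduct.includeRight_injective (R := k) (A := F) (B := R)
        (algebraMap k F).injective
      exact this (by simpa using h))
    (by rw [derF_tmul, hDf, tmul_zero]) (kerF hker)
  obtain ⟨r, p, hp, hr, hdvd⟩ := descent hf hDf hker hm hr' hdv
  have hp0 : aeval f p ≠ 0 := fun h => hp (transcendental_iff.mp hf _ h)
  obtain ⟨D', hD', hDD⟩ := div_der hD (aeval_der_zero hDf p) hp0 hdvd
  have hs : D' r = 1 := mul_left_cancel₀ hp0 (by rw [← hDD, hr, mul_one])
  refine ⟨f, r, ?_⟩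
  rw [eq_top_iff]
  intro a _
  obtain ⟨P, rfl⟩ := slice_surj hD' hs a
  rw [aeval_eq_sum_range]
  refine Subalgebra.sum_mem _ fun i _ => ?_
  rw [Algebra.smul_def]
  refine Subalgebra.mul_mem _ ?_ (Subalgebra.pow_mem _ (Algebra.subset_adjoin (by simp)) _)
  obtain ⟨Q, hQ⟩ := hker (P.coeff i : R) (by rw [hDD, (P.coeff i).2, mul_zero])
  change ((P.coeff i : kerS D') : R) ∈ _
  rw [hQ]
  have h1 : aeval f Q ∈ Algebra.adjoin k {f} := aeval_mem_adjoin_singleton k f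
  exact Algebra.adjoin_mono (by simp) h1

end canc

end Canc

namespace Canc

section fin

open Polynomial

variable {k : Type} [Field k] [CharZero k]

lemma two_coords (D : Derivation k (MvPolynomial (Fin 3) k) (MvPolynomial (Fin 3) k))
    (hD : Lnil D) {s : MvPolynomial (Fin 3) k} (hs : D s = 1) :
    ∃ u v, D u = 0 ∧ D v = 0 ∧ Algebra.adjoin k {u, v, s} = ⊤ := by
  have hbij : Function.Bijective ((aeval (R := kerS D) s).restrictScalars k) := by
    refine ⟨?_, slice_surj hD hs⟩
    have ht := transc_of_slice (D := D) (a := s) (by rw [hs]; exact one_ne_zero)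
    exact transcendental_iff_injective.mp ht
  let φ : (kerS D)[X] ≃ₐ[k] MvPolynomial (Fin 3) k := AlgEquiv.ofBijective _ hbij
  obtain ⟨f, g, hfg⟩ := cancellation φ
  refine ⟨f, g, f.2, g.2, ?_⟩
  rw [eq_top_iff]
  intro a _
  obtain ⟨P, rfl⟩ := slice_surj hD hs a
  rw [aeval_eq_sum_range]
  refine Subalgebra.sum_mem _ fun i _ => ?_
  rw [Algebra.smul_def]
  refine Subalgebra.mul_mem _ ?_ (Subalgebra.pow_mem _ (Algebra.subset_adjoin (by simp)) _)
  have h1 : P.coeff i ∈ Algebra.adjoin k {f, g} := by rw [hfg]; trivial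
  have h2 : (P.coeff i : MvPolynomial (Fin 3) k) ∈
      (Algebra.adjoin k {f, g}).map (kerS D).val := ⟨_, h1, rfl⟩
  rw [AlgHom.map_adjoin] at h2
  refine Algebra.adjoin_mono ?_ h2
  rintro _ ⟨x, hx, rfl⟩
  rcases hx with rfl | rfl <;> simp

/-- The elements whose image is divisible by `d` form a subalgebra. -/
lemma dvd_of_gen (D : Derivation k (MvPolynomial (Fin 3) k) (MvPolynomial (Fin 3) k))
    (d : MvPolynomial (Fin 3) k) (S : Set (MvPolynomial (Fin 3) k)) (hS : ∀ x ∈ S, d ∣ D x)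
    (htop : Algebra.adjoin k S = ⊤) (a : MvPolynomial (Fin 3) k) : d ∣ D a := by
  have ha : a ∈ Algebra.adjoin k S := by rw [htop]; trivial
  induction ha using Algebra.adjoin_induction with
  | mem x hx => exact hS x hx
  | algebraMap r => rw [Derivation.map_algebraMap]; exact dvd_zero _
  | add x y _ _ hx hy => rw [map_add]; exact dvd_add hx hy
  | mul x y _ _ hx hy =>
    rw [Derivation.leibniz]
    exact dvd_add (hy.mul_left _) (hx.mul_left _)

end fin

end Canc

/-- A generator `c` of the plinth ideal of an irreducible locally nilpotent derivation of
`K[x,y,z]` satisfies: `rank X = 1` iff `c` is a nonzero constant. -/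
theorem rank_one_iff {K : Type} [Field K] [CharZero K]
    (X : Derivation K (PolyR K) (PolyR K))
    (hln : LND K X) (hirr : IrredDer K X)
    (c : PolyR K) (hc : IsPlinthGen K X c) :
    rankD K X = 1 ↔ ∃ k : K, k ≠ 0 ∧ c = MvPolynomial.C k := by
  have hL : Canc.Lnil X := fun a => by
    obtain ⟨n, _, hn⟩ := hln a
    exact ⟨n, hn⟩
  set T : Set ℕ := {r : ℕ | ∃ l : List (PolyR K), l.length = r ∧ (∀ f ∈ l, X f = 0) ∧
    ∃ m : List (PolyR K), (l ++ m).length = 3 ∧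
      Algebra.adjoin K {a : PolyR K | a ∈ l ++ m} = ⊤} with hT
  have hcor : corank K X = sSup T := rfl
  have hbd : ∀ r ∈ T, r ≤ 2 := by
    rintro r ⟨l, rfl, hl, m, hlen, htop⟩
    by_contra hgt
    have hm : m = [] := by
      rw [List.length_append] at hlen
      exact List.eq_nil_of_length_eq_zero (by omega)
    subst hm
    have h0 := Canc.dvd_of_gen X 0 _ (fun x hx => by
      rw [hl x (by simpa using hx)]) htop
    exact not_isUnit_zero (hirr 0 fun i => h0 _)
  have hbdd : BddAbove T := ⟨2, hbd⟩
  constructor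
  · intro hrank
    have h2 : sSup T = 2 := by
      rw [rankD, hcor] at hrank
      omega
    have hne : T.Nonempty := by
      by_contra hemp
      rw [Set.not_nonempty_iff_eq_empty] at hemp
      rw [hemp] at h2
      simp at h2
    have hmem := Nat.sSup_mem hne hbdd
    rw [h2] at hmem
    obtain ⟨l, hl2, hl, m, hlen, htop⟩ := hmem
    have hm1 : m.length = 1 := by
      rw [List.length_append] at hlen
      omega
    obtain ⟨w, rfl⟩ := List.length_eq_one_iff.mp hm1
    have hdv := Canc.dvd_of_gen X (X w) _ (fun x hx => by
      have hx' : x ∈ l ++ [w] := hx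
      rw [List.mem_append, List.mem_singleton] at hx'
      rcases hx' with hx' | rfl
      · rw [hl x hx']; exact dvd_zero _
      · exact dvd_rfl) htop
    have hu : IsUnit (X w) := hirr _ fun i => hdv _
    obtain ⟨a, ha, hXa⟩ := MvPolynomial.isUnit_iff_eq_C_of_isReduced.mp hu
    have hmemS : X w ∈ {d : PolyR K | ∃ a : PolyR K, X a = d ∧ X (X a) = 0} :=
      ⟨w, rfl, by rw [hXa]; exact X.map_algebraMap a⟩
    rw [hc] at hmemS
    obtain ⟨r, _, hr⟩ := hmemS
    have hcu : IsUnit c := isUnit_of_dvd_unit ⟨r, by rw [hr, mul_comm]⟩ hu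
    obtain ⟨b, hb, hcb⟩ := MvPolynomial.isUnit_iff_eq_C_of_isReduced.mp hcu
    exact ⟨b, hb.ne_zero, hcb⟩
  · rintro ⟨b, hb, rfl⟩
    have hmemS : (MvPolynomial.C b : PolyR K) ∈
        {d : PolyR K | ∃ r : PolyR K, X r = 0 ∧ d = r * MvPolynomial.C b} :=
      ⟨1, X.map_one_eq_zero, (one_mul _).symm⟩
    rw [← hc] at hmemS
    obtain ⟨a, ha, _⟩ := hmemS
    have hs : X (b⁻¹ • a) = 1 := by
      rw [Derivation.map_smul, ha, MvPolynomial.smul_eq_C_mul, ← MvPolynomial.C_mul,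
        inv_mul_cancel₀ hb, MvPolynomial.C_1]
    obtain ⟨u, v, hu, hv, htop⟩ := Canc.two_coords X hL hs
    have hmem : 2 ∈ T := by
      refine ⟨[u, v], rfl, ?_, [b⁻¹ • a], rfl, ?_⟩
      · intro f hf
        simp only [List.mem_cons, List.not_mem_nil, or_false] at hf
        rcases hf with rfl | rfl
        · exact hu
        · exact hv
      · rw [← htop]
        congr 1
        ext x
        simp
    have h2 : sSup T = 2 := le_antisymm (csSup_le ⟨2, hmem⟩ hbd) (le_csSup hbdd hmem)
    rw [rankD, hcor, h2]

end
end

section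
/- Let K be a field of characteristic zero, X a nonzero irreducible locally nilpotent K-derivation of K[x,y,z], and u a coordinate of K[x,y,z] with X(u) = 0. Then there exists p ∈ K[x,y,z] such that K[x,y,z]^X = K[u,p], and every generator c of the plinth ideal S^X belongs to K[u], i.e. c = ℓ(u) for some univariate polynomial ℓ over K. -/
noncomputable section

variable (K : Type) [Field K] [CharZero K]

/-! ### General facts on derivations -/

/-- Leibniz rule for the extreme iterates. -/
theorem hl_leibniz {S B : Type} [CommRing S] [CommRing B] [Algebra S B] (D : Derivation S B B) :
    ∀ N m n : ℕ, m + n = N → ∀ a b : B, (⇑D)^[m + 1] a = 0 → (⇑D)^[n + 1] b = 0 →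
      (⇑D)^[m + n] (a * b) = ((m + n).choose m : B) * ((⇑D)^[m] a * (⇑D)^[n] b) ∧
      (⇑D)^[m + n + 1] (a * b) = 0 := by
  have key : ∀ j (x y : B), (⇑D)^[j] (x + y) = (⇑D)^[j] x + (⇑D)^[j] y := by
    intro j x y
    exact iterate_map_add D j x y
  have hz : ∀ j, (⇑D)^[j] 0 = 0 := fun j => iterate_map_zero D j
  intro N
  induction N with
  | zero =>
    intro m n h a b ha hb
    obtain ⟨rfl, rfl⟩ : m = 0 ∧ n = 0 := by omega
    simp at ha hb
    simp [ha, hb]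
  | succ N ih =>
    intro m n h a b ha hb
    have h1 : (⇑D)^[m + n] (a * b) =
        ((m + n).choose m : B) * ((⇑D)^[m] a * (⇑D)^[n] b) := by
      rw [h, Function.iterate_succ_apply, D.leibniz, key, smul_eq_mul, smul_eq_mul]
      rcases m with _ | m
      · have hn : n = N + 1 := by omega
        subst hn
        simp at ha
        rw [ha, mul_zero, hz]
        have := (ih 0 N (by omega) a (D b) (by simpa using ha)
          (by simpa [Function.iterate_succ_apply] using hb)).1
        simp at this
        simp [this]
      · rcases n with _ | n
        · have hn : m = N := by omega
          subst hn
          simp at hb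
          rw [hb, mul_zero, hz]
          have := (ih m 0 (by omega) (D a) b
            (by simpa [Function.iterate_succ_apply] using ha) (by simpa using hb)).1
          simp at this
          simp [mul_comm b, this]
        · have e1 := (ih (m + 1) n (by omega) a (D b) ha
            (by simpa [Function.iterate_succ_apply] using hb)).1
          have e2 := (ih m (n + 1) (by omega) (D a) b
            (by simpa [Function.iterate_succ_apply] using ha) hb).1
          have hN : N = m + 1 + n := by omega
          have hN' : N = m + (n + 1) := by omega
          rw [← hN] at e1
          rw [← hN'] at e2
          rw [e1, mul_comm b, e2, Nat.choose_succ_succ]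
          push_cast
          simp only [Function.iterate_succ_apply]
          ring
    refine ⟨h1, ?_⟩
    rw [Function.iterate_succ_apply, D.leibniz, key, smul_eq_mul, smul_eq_mul]
    have e1 : (⇑D)^[m + n] (a * D b) = 0 := by
      rcases n with _ | n
      · simp at hb
        rw [hb, mul_zero, hz]
      · exact (ih m n (by omega) a (D b) ha
            (by simpa [Function.iterate_succ_apply] using hb)).2
    have e2 : (⇑D)^[m + n] (b * D a) = 0 := by
      rcases m with _ | m
      · simp at ha
        rw [ha, mul_zero, hz]
      · have := (ih m n (by omega) (D a) b
            (by simpa [Function.iterate_succ_apply] using ha) hb).2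
        rw [mul_comm, show m + 1 + n = m + n + 1 by omega]
        exact this
    rw [e1, e2, add_zero]

/-- Local nilpotency, for a general derivation. -/
def HLND {S B : Type} [CommRing S] [CommRing B] [Algebra S B] (D : Derivation S B B) : Prop :=
  ∀ a : B, ∃ n : ℕ, (⇑D)^[n] a = 0

theorem HLND.exists_top {S B : Type} [CommRing S] [CommRing B] [Algebra S B]
    {D : Derivation S B B} (h : HLND D) (a : B) (ha : a ≠ 0) :
    ∃ n : ℕ, (⇑D)^[n] a ≠ 0 ∧ (⇑D)^[n + 1] a = 0 := by
  classical
  have hm := Nat.find_spec (h a)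
  have hl := fun m => Nat.find_min (h a) (m := m)
  generalize Nat.find (h a) = k at hm hl
  rcases k with _ | k
  · exact absurd hm ha
  · exact ⟨k, hl k (by omega), hm⟩

/-- The kernel of a locally nilpotent derivation is factorially closed. -/
theorem HLND.fact_closed {S B : Type} [CommRing S] [CommRing B] [Algebra S B]
    [IsDomain B] [CharZero B]
    {D : Derivation S B B} (h : HLND D) (a b : B) (hab : a * b ≠ 0) (hD : D (a * b) = 0) :
    D a = 0 := by
  obtain ⟨m, hm, hm'⟩ := h.exists_top a (left_ne_zero_of_mul hab)
  obtain ⟨n, hn, hn'⟩ := h.exists_top b (right_ne_zero_of_mul hab)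
  have e := (hl_leibniz D _ m n rfl a b hm' hn').1
  have hne : (⇑D)^[m + n] (a * b) ≠ 0 := by
    rw [e]
    refine mul_ne_zero ?_ (mul_ne_zero hm hn)
    exact_mod_cast (Nat.choose_pos (by omega : m ≤ m + n)).ne'
  rcases m with _ | m
  · simpa using hm'
  · exfalso
    apply hne
    rw [show m + 1 + n = m + n + 1 by omega, Function.iterate_succ_apply, hD]
    exact iterate_map_zero D _

/-- Elements algebraic (modulo a stable prime `Q`) over constants are constants. -/
theorem hl_alg {S S0 B : Type} [CommRing S0] [CommRing S] [IsDomain S] [CharZero S]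
    [CommRing B] [Algebra S0 B] (D : Derivation S0 B B) (φ : S →+* B) (Q : Ideal B) [Q.IsPrime]
    (hDS : ∀ s, D (φ s) ∈ Q) (hSQ : ∀ s, φ s ∈ Q → s = 0) (hDQ : ∀ b ∈ Q, D b ∈ Q) (b : B) :
    ∀ (N : ℕ) (g : Polynomial S), g.natDegree = N → g ≠ 0 → g.eval₂ φ b ∈ Q → D b ∈ Q := by
  have hder : ∀ g : Polynomial S, D (g.eval₂ φ b) - g.derivative.eval₂ φ b * D b ∈ Q := by
    intro g
    induction g using Polynomial.induction_on' with
    | add p q hp hq =>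
      simp only [Polynomial.eval₂_add, map_add]
      convert Q.add_mem hp hq using 1
      ring
    | monomial n a =>
      simp only [Polynomial.eval₂_monomial, Polynomial.derivative_monomial, D.leibniz,
        D.leibniz_pow, smul_eq_mul, nsmul_eq_mul, map_mul, map_natCast]
      convert Q.mul_mem_left (b ^ n) (hDS a) using 1
      ring
  intro N
  induction N using Nat.strong_induction_on with
  | _ N ih =>
    intro g hN hg hgQ
    have h1 : g.derivative.eval₂ φ b * D b ∈ Q := by
      have := Q.sub_mem (hDQ _ hgQ) (hder g)
      simpa using this
    rcases Ideal.IsPrime.mem_or_mem ‹Q.IsPrime› h1 with h2 | h2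
    · by_cases h0 : g.natDegree = 0
      · exfalso
        rw [Polynomial.eq_C_of_natDegree_eq_zero h0, Polynomial.eval₂_C] at hgQ
        apply hg
        rw [Polynomial.eq_C_of_natDegree_eq_zero h0, hSQ _ hgQ, map_zero]
      · refine ih g.derivative.natDegree ?_ _ rfl ?_ h2
        · rw [← hN]
          exact Polynomial.natDegree_derivative_lt h0
        · intro h3
          exact h0 (Polynomial.derivative_eq_zero.mp h3)
    · exact h2

/-- Cancelling the outer variable. -/
theorem hl_cancel {T B : Type} [CommRing T] [CommRing B] [IsDomain B] (ψ : T →+* B) (n : B)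
    (hn : n ≠ 0) : ∀ (N : ℕ) (G : Polynomial T), G.natDegree = N → G ≠ 0 → G.eval₂ ψ n = 0 →
      ∃ g : T, g ≠ 0 ∧ n ∣ ψ g := by
  intro N
  induction N using Nat.strong_induction_on with
  | _ N ih =>
    intro G hN hG h0
    have hd := Polynomial.divX_mul_X_add G
    have he : G.divX.eval₂ ψ n * n + ψ (G.coeff 0) = 0 := by
      rw [← hd] at h0
      simpa [Polynomial.eval₂_add, Polynomial.eval₂_mul] using h0
    by_cases hc : G.coeff 0 = 0
    · rw [hc, map_zero, add_zero] at he
      have h1 := (mul_eq_zero.mp he).resolve_right hn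
      have h2 : G.divX ≠ 0 := by
        intro h
        apply hG
        rw [← hd, h, hc]
        simp
      have h3 : G.natDegree ≠ 0 := by
        intro h
        apply hG
        rw [Polynomial.eq_C_of_natDegree_eq_zero h, hc, map_zero]
      refine ih G.divX.natDegree ?_ _ rfl h2 h1
      rw [Polynomial.natDegree_divX_eq_natDegree_tsub_one]
      omega
    · refine ⟨_, hc, -G.divX.eval₂ ψ n, ?_⟩
      linear_combination he

theorem hl_prime_dvd {S B : Type} [CommRing S] [CommRing B] [IsDomain B] (φ : S →+* B)
    (P : Ideal B) (hSP : ∀ s, φ s ∈ P → s = 0) (n a : B) (hn : Prime n)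
    (hnP : n ∈ P) (haP : a ∈ P) : ∀ (N : ℕ) (g : Polynomial S), g.natDegree = N → g ≠ 0 →
      n ∣ g.eval₂ φ a → n ∣ a := by
  intro N
  induction N using Nat.strong_induction_on with
  | _ N ih =>
    intro G hN hG h0
    have hd := Polynomial.divX_mul_X_add G
    have he : G.eval₂ φ a = G.divX.eval₂ φ a * a + φ (G.coeff 0) := by
      conv_lhs => rw [← hd]
      simp [Polynomial.eval₂_add, Polynomial.eval₂_mul]
    by_cases hc : G.coeff 0 = 0
    · rw [he, hc, map_zero, add_zero] at h0
      rcases hn.dvd_or_dvd h0 with h1 | h1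
      · have h2 : G.divX ≠ 0 := by
          intro h
          apply hG
          rw [← hd, h, hc]
          simp
        have h3 : G.natDegree ≠ 0 := by
          intro h
          apply hG
          rw [Polynomial.eq_C_of_natDegree_eq_zero h, hc, map_zero]
        refine ih G.divX.natDegree ?_ _ rfl h2 h1
        rw [Polynomial.natDegree_divX_eq_natDegree_tsub_one]
        omega
      · exact h1
    · exfalso
      apply hc
      apply hSP
      have h1 : G.eval₂ φ a ∈ P := P.mem_of_dvd h0 hnP
      have : φ (G.coeff 0) = G.eval₂ φ a - G.divX.eval₂ φ a * a := by
        rw [he]; ring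
      rw [this]
      exact P.sub_mem h1 (P.mul_mem_left _ haP)

/-- evaluation `R[X] → B` -/
abbrev ev1h {R B : Type} [CommRing R] [CommRing B] (φ : R →+* B) (a : B) :
    Polynomial R →+* B := Polynomial.eval₂RingHom φ a

set_option maxHeartbeats 1000000 in
/-- Three polynomials in two variables are dependent. -/
theorem hl_dep3 {R : Type} [CommRing R] [IsDomain R] (a b c : MvPolynomial (Fin 2) R) :
    ∃ G : Polynomial (Polynomial (Polynomial R)), G ≠ 0 ∧
      G.eval₂ (ev1h (ev1h MvPolynomial.C a) b) c = 0 := by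
  by_contra! hcon
  -- the evaluation map is injective
  have hinj : ∀ G, (ev1h (ev1h (ev1h MvPolynomial.C a) b) c) G = 0 → G = 0 := by
    intro G hG
    by_contra h
    exact hcon G h hG
  let x : Fin 3 → Polynomial (Polynomial (Polynomial R)) :=
    ![Polynomial.C (Polynomial.C Polynomial.X), Polynomial.C Polynomial.X, Polynomial.X]
  let y : Fin 3 → MvPolynomial (Fin 2) R := ![a, b, c]
  have hcomp : ∀ p : MvPolynomial (Fin 3) R, MvPolynomial.aeval y p =
      (ev1h (ev1h (ev1h MvPolynomial.C a) b) c) (MvPolynomial.aeval x p) := by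
    intro p
    induction p using MvPolynomial.induction_on with
    | C r => simp [Polynomial.algebraMap_apply]
    | add p q hp hq => rw [map_add, hp, hq, map_add, map_add]
    | mul_X p i hp =>
      rw [map_mul, hp, map_mul, map_mul]
      congr 1
      fin_cases i <;> simp [x, y]
  have hx : Function.Injective (MvPolynomial.aeval (R := R) x) := by
    have hl : ∀ p : MvPolynomial (Fin 3) R,
        (ev1h (ev1h (ev1h MvPolynomial.C (MvPolynomial.X 0)) (MvPolynomial.X 1))
          (MvPolynomial.X 2)) (MvPolynomial.aeval x p) = p := by
      intro p
      induction p using MvPolynomial.induction_on with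
      | C r => simp [Polynomial.algebraMap_apply]
      | add p q hp hq => rw [map_add, map_add, hp, hq]
      | mul_X p i hp =>
        rw [map_mul, map_mul, hp]
        congr 1
        fin_cases i <;> simp [x]
    exact Function.LeftInverse.injective hl
  have hy : AlgebraicIndependent R y := by
    rw [algebraicIndependent_iff]
    intro p hp
    rw [hcomp] at hp
    have := hinj _ hp
    exact hx (by rw [this, map_zero])
  have := hy.lift_cardinalMk_le_trdeg
  rw [MvPolynomial.trdeg_of_isDomain] at this
  simp at this
  exact absurd this (by norm_num)

open MvPolynomial in
theorem hl_dep2 {R : Type} [CommRing R] [IsDomain R] [CharZero R]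
    (D : Derivation R (MvPolynomial (Fin 2) R) (MvPolynomial (Fin 2) R)) (hD : D ≠ 0)
    (c p : MvPolynomial (Fin 2) R) (hc : D c = 0) (hp : D p = 0) :
    ∃ G : Polynomial (Polynomial R), G ≠ 0 ∧ G.eval₂ (ev1h C c) p = 0 := by
  by_contra! hcon
  apply hD
  refine Derivation.ext fun b => ?_
  have hder1 : ∀ s : Polynomial R, D (ev1h C c s) = 0 := by
    intro s
    induction s using Polynomial.induction_on' with
    | add p q hp hq => rw [map_add, map_add, hp, hq, add_zero]
    | monomial n a => simp [D.leibniz, D.leibniz_pow, hc]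
  have hder : ∀ s : Polynomial (Polynomial R), D (ev1h (ev1h C c) p s) = 0 := by
    intro s
    induction s using Polynomial.induction_on' with
    | add p q hp hq => rw [map_add, map_add, hp, hq, add_zero]
    | monomial n a =>
      have := hder1 a
      simp only [Polynomial.coe_eval₂RingHom] at this
      simp [D.leibniz, D.leibniz_pow, hp, this]
  obtain ⟨G, hG, hG0⟩ := hl_dep3 c p b
  have := hl_alg D (ev1h (ev1h C c) p) (⊥ : Ideal (MvPolynomial (Fin 2) R))
    (fun s => by simpa using hder s)
    (fun s hs => by
      by_contra h
      exact hcon s h (by simpa using hs))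
    (fun b hb => by
      have : b = 0 := by simpa using hb
      simp [this]) b _ G rfl hG (by simpa using hG0)
  simpa using this

/-- A prime factor of `c` inside a prime ideal containing `c`. -/
theorem hl_prime_factor {B : Type} [CommRing B] [IsDomain B] [UniqueFactorizationMonoid B]
    (P : Ideal B) [hP : P.IsPrime] (c : B) (hc : c ≠ 0) (hcP : c ∈ P) :
    ∃ n, Prime n ∧ n ∈ P ∧ n ∣ c := by
  induction c using UniqueFactorizationMonoid.induction_on_prime with
  | h₁ => exact absurd rfl hc
  | h₂ x hx => exact absurd (Ideal.eq_top_of_isUnit_mem P hcP hx) hP.ne_top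
  | h₃ a p ha hp ih =>
    rcases hP.mem_or_mem hcP with h | h
    · exact ⟨p, hp, h, dvd_mul_right _ _⟩
    · obtain ⟨n, h1, h2, h3⟩ := ih ha h
      exact ⟨n, h1, h2, h3.mul_left p⟩

open MvPolynomial in
theorem hl_totalDegree_pos {R : Type} [CommRing R] [IsDomain R] (p : MvPolynomial (Fin 2) R)
    (hp : p ≠ 0) (h0 : constantCoeff p = 0) : 0 < p.totalDegree := by
  rw [Nat.pos_iff_ne_zero]
  intro h
  rw [totalDegree_eq_zero_iff_eq_C] at h
  apply hp
  rw [h]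
  have : coeff 0 p = 0 := h0
  rw [this, map_zero]

open MvPolynomial in
/-- The kernel of a nonzero locally nilpotent derivation of `R[v,w]` is `R[p]`. -/
theorem hl_kernel {R : Type} [CommRing R] [IsDomain R] [CharZero R] [UniqueFactorizationMonoid R]
    (D : Derivation R (MvPolynomial (Fin 2) R) (MvPolynomial (Fin 2) R)) (hD : D ≠ 0)
    (hln : HLND D) :
    ∃ p, D p = 0 ∧ ∀ a, D a = 0 → ∃ q : Polynomial R, a = Polynomial.aeval p q := by
  by_cases hex : ∃ c, D c = 0 ∧ constantCoeff c = 0 ∧ c ≠ 0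
  · obtain ⟨c0, hc0, hc0', hc0n⟩ := hex
    let P : Ideal (MvPolynomial (Fin 2) R) := RingHom.ker (constantCoeff (σ := Fin 2) (R := R))
    have hPp : P.IsPrime := RingHom.ker_isPrime _
    obtain ⟨p, hpp, hpP, hpd⟩ := hl_prime_factor P c0 hc0n hc0'
    have hp0 : D p = 0 := by
      obtain ⟨e, rfl⟩ := hpd
      exact hln.fact_closed p e hc0n hc0
    have hdeg := hl_totalDegree_pos p hpp.ne_zero hpP
    refine ⟨p, hp0, ?_⟩
    have main : ∀ N, ∀ a : MvPolynomial (Fin 2) R, a.totalDegree = N → D a = 0 →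
        ∃ q : Polynomial R, a = Polynomial.aeval p q := by
      intro N
      induction N using Nat.strong_induction_on with
      | _ N ih =>
        intro a hN ha
        by_cases hz : a - C (constantCoeff a) = 0
        · exact ⟨Polynomial.C (constantCoeff a), by
            simpa [sub_eq_zero, algebraMap_eq] using hz⟩
        · have hb0 : D (a - C (constantCoeff a)) = 0 := by simp [ha, derivation_C]
          have hbP : a - C (constantCoeff a) ∈ P := by simp [P, RingHom.mem_ker]
          have hdle : (a - C (constantCoeff a)).totalDegree ≤ a.totalDegree := by
            refine (totalDegree_sub _ _).trans ?_
            simp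
          obtain ⟨G, hG, hG0⟩ := hl_dep2 D hD _ p hb0 hp0
          obtain ⟨g, hg, hgd⟩ := hl_cancel _ p hpp.ne_zero _ G rfl hG hG0
          have hd := hl_prime_dvd (C : R →+* MvPolynomial (Fin 2) R) P
            (fun s hs => by simpa [P, RingHom.mem_ker] using hs) p _ hpp hpP hbP _ g rfl hg hgd
          obtain ⟨e, he⟩ := hd
          have hene : e ≠ 0 := by
            rintro rfl
            exact hz (by simpa using he)
          have he0 : D e = 0 := by
            refine hln.fact_closed e p ?_ ?_
            · exact mul_ne_zero hene hpp.ne_zero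
            · rw [mul_comm, ← he, hb0]
          have hlt : e.totalDegree < N := by
            rw [he, totalDegree_mul_of_isDomain hpp.ne_zero hene] at hdle
            omega
          obtain ⟨q, hq⟩ := ih _ hlt e rfl he0
          refine ⟨Polynomial.X * q + Polynomial.C (constantCoeff a), ?_⟩
          rw [map_add, map_mul, Polynomial.aeval_X, ← hq, ← he, Polynomial.aeval_C,
            algebraMap_eq]
          ring
    intro a ha
    exact main _ a rfl ha
  · push Not at hex
    refine ⟨0, by simp, fun a ha => ⟨Polynomial.C (constantCoeff a), ?_⟩⟩
    have := hex (a - C (constantCoeff a)) (by simp [ha, derivation_C]) (by simp)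
    simpa [sub_eq_zero, algebraMap_eq] using this

open MvPolynomial in
/-- Existence of a slice over an algebraically closed field. -/
theorem hl_slice {F : Type} [Field F] [IsAlgClosed F] [CharZero F]
    (D : Derivation F (MvPolynomial (Fin 2) F) (MvPolynomial (Fin 2) F)) (hD : D ≠ 0)
    (hln : HLND D) (H : ∀ n, Prime n → ¬ ∀ b, n ∣ D b) : ∃ s, D s = 1 := by
  classical
  have hex : ∃ N, ∃ s, D s ≠ 0 ∧ D (D s) = 0 ∧ (D s).totalDegree = N := by
    obtain ⟨a, ha⟩ : ∃ a, D a ≠ 0 := by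
      by_contra! h
      exact hD (Derivation.ext h)
    obtain ⟨n, hn, hn'⟩ := hln.exists_top (D a) ha
    refine ⟨_, (⇑D)^[n] a, ?_, ?_, rfl⟩
    · rw [← Function.iterate_succ_apply' D, Function.iterate_succ_apply]
      exact hn
    · rw [← Function.iterate_succ_apply' D, ← Function.iterate_succ_apply' D,
        Function.iterate_succ_apply]
      exact hn'
  obtain ⟨s, hs, hs', hsN⟩ := Nat.find_spec hex
  have hmin := fun m => Nat.find_min hex (m := m)
  rw [← hsN] at hmin
  by_cases hu : IsUnit (D s)
  · obtain ⟨e, he⟩ := hu.exists_left_inv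
    have he0 : D e = 0 := by
      refine hln.fact_closed e (D s) ?_ ?_
      · rw [he]; exact one_ne_zero
      · rw [he]; simp
    refine ⟨e * s, ?_⟩
    rw [D.leibniz, he0, smul_eq_mul, he]
    simp
  · exfalso
    obtain ⟨n, hn, hnd⟩ := WfDvdMonoid.exists_irreducible_factor hu hs
    have hn := hn.prime
    have hn0 : D n = 0 := by
      obtain ⟨e, he⟩ := hnd
      refine hln.fact_closed n e ?_ ?_
      · rw [← he]; exact hs
      · rw [← he]; exact hs'
    let Q := Ideal.span {n}
    have hQ : ∀ b, b ∈ Q ↔ n ∣ b := fun b => Ideal.mem_span_singleton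
    have hQp : Q.IsPrime := (Ideal.span_singleton_prime hn.ne_zero).mpr hn
    by_cases htr : ∃ g : Polynomial F, g ≠ 0 ∧ n ∣ Polynomial.aeval s g
    · obtain ⟨g, hg, hgd⟩ := htr
      have : ∃ α : F, n ∣ s - C α := by
        rw [(IsAlgClosed.splits g).eq_prod_roots] at hgd
        rw [map_mul, Polynomial.aeval_C] at hgd
        rcases hn.dvd_or_dvd hgd with h | h
        · exfalso
          refine hn.not_isUnit (isUnit_of_dvd_unit h ?_)
          exact (IsUnit.mk0 _ (Polynomial.leadingCoeff_ne_zero.mpr hg)).map _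
        · rw [map_multiset_prod] at h
          obtain ⟨x, hx, hxd⟩ := hn.exists_mem_multiset_dvd h
          rw [Multiset.map_map, Multiset.mem_map] at hx
          obtain ⟨α, -, rfl⟩ := hx
          exact ⟨α, by simpa [algebraMap_eq] using hxd⟩
      obtain ⟨α, s', hs''⟩ := this
      have hDs : D s = n * D s' := by
        have := congrArg D hs''
        simpa [derivation_C, D.leibniz, hn0] using this
      have hne : D s' ≠ 0 := by
        intro h
        apply hs
        rw [hDs, h, mul_zero]
      have hk : D (D s') = 0 := by
        refine hln.fact_closed (D s') n ?_ ?_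
        · exact mul_ne_zero hne hn.ne_zero
        · rw [mul_comm, ← hDs, hs']
      refine hmin (D s').totalDegree ?_ ⟨s', hne, hk, rfl⟩
      rw [hDs, totalDegree_mul_of_isDomain hn.ne_zero hne]
      have : n.totalDegree ≠ 0 := by
        intro h
        rw [totalDegree_eq_zero_iff_eq_C] at h
        apply hn.not_isUnit
        rw [h]
        refine (IsUnit.mk0 _ ?_).map _
        intro h'
        apply hn.ne_zero
        rw [h, h', map_zero]
      omega
    · push Not at htr
      apply H n hn
      intro b
      rw [← hQ]
      obtain ⟨G, hG, hG0⟩ := hl_dep3 s b n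
      obtain ⟨g, hg, hgd⟩ := hl_cancel _ n hn.ne_zero _ G rfl hG hG0
      refine hl_alg D (ev1h C s) Q ?_ ?_ ?_ b _ g rfl hg ((hQ _).mpr hgd)
      · intro t
        have : (ev1h C s) t = Polynomial.aeval s t := rfl
        rw [this, Derivation.map_aeval, smul_eq_mul]
        exact Q.mul_mem_left _ ((hQ _).mpr hnd)
      · intro t ht
        by_contra h
        exact htr t h ((hQ _).mp ht)
      · intro b hb
        obtain ⟨e, rfl⟩ := (hQ _).mp hb
        rw [hQ, D.leibniz, hn0]
        simp

open MvPolynomial in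
theorem hl_retract {k F : Type} [Field k] [Field F] [Algebra k F] :
    ∃ Λ : MvPolynomial (Fin 2) F → MvPolynomial (Fin 2) k,
      Λ 1 = 1 ∧ (∀ f g, Λ (f + g) = Λ f + Λ g) ∧
      (∀ f b, Λ (f * map (algebraMap k F) b) = Λ f * b) ∧
      (∀ i f, Λ (pderiv i f) = pderiv i (Λ f)) := by
  obtain ⟨ρ, hρ⟩ := (Algebra.linearMap k F).exists_leftInverse_of_injective
    (LinearMap.ker_eq_bot.mpr (algebraMap k F).injective)
  have hρ1 : ρ 1 = 1 := by
    have := LinearMap.congr_fun hρ 1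
    simpa using this
  let Λ : MvPolynomial (Fin 2) F → MvPolynomial (Fin 2) k :=
    fun f => ∑ m ∈ f.support, monomial m (ρ (coeff m f))
  have hΛ : ∀ f m, coeff m (Λ f) = ρ (coeff m f) := by
    intro f m
    classical
    simp only [Λ, coeff_sum, coeff_monomial, Finset.sum_ite_eq', mem_support_iff]
    split_ifs with h
    · rfl
    · push Not at h
      rw [h, map_zero]
  have hmulr : ∀ x c, ρ (x * algebraMap k F c) = ρ x * c := by
    intro x c
    rw [mul_comm, ← Algebra.smul_def, map_smul, smul_eq_mul, mul_comm]
  refine ⟨Λ, ?_, ?_, ?_, ?_⟩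
  · ext m
    classical
    rw [hΛ, coeff_one, coeff_one]
    split_ifs <;> simp [hρ1]
  · intro f g
    ext m
    simp [hΛ]
  · intro f b
    ext m
    rw [hΛ, coeff_mul, coeff_mul, map_sum]
    refine Finset.sum_congr rfl fun x _ => ?_
    rw [coeff_map, hmulr, hΛ]
  · intro i f
    ext m
    rw [hΛ, coeff_pderiv, coeff_pderiv, hΛ]
    have := hmulr (coeff (m + Finsupp.single i 1) f) ((m i : k) + 1)
    simpa using this

open MvPolynomial in
/-- A polynomial dividing nonzero polynomials in each single variable is constant. -/
theorem hl_const_of_dvd {F : Type} [Field F] (n : MvPolynomial (Fin 2) F) (hn : Prime n)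
    (h : ∀ i : Fin 2, ∃ g : Polynomial F, g ≠ 0 ∧ n ∣ Polynomial.aeval (X i) g) : False := by
  have hz : ∀ i j : Fin 2, i ≠ j → degreeOf j n = 0 := by
    intro i j hij
    obtain ⟨g, hg, e, he⟩ := h i
    have hne : (Polynomial.aeval (X i : MvPolynomial (Fin 2) F)) g ≠ 0 := by
      intro h0
      exact hg ((transcendental_iff.mp (transcendental_X F i)) g h0)
    have hd : degreeOf j (Polynomial.aeval (X i : MvPolynomial (Fin 2) F) g) = 0 := by
      rw [← Nat.le_zero, Polynomial.aeval_eq_sum_range]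
      refine (degreeOf_sum_le _ _ _).trans ?_
      refine Finset.sup_le fun m _ => ?_
      rw [smul_eq_C_mul]
      refine (degreeOf_C_mul_le _ _ _).trans ?_
      refine (degreeOf_pow_le _ _ _).trans ?_
      rw [degreeOf_X, if_neg hij.symm]
      simp
    rw [he] at hd hne
    rw [degreeOf_mul_eq (left_ne_zero_of_mul hne) (right_ne_zero_of_mul hne)] at hd
    omega
  have h0 : ∀ j : Fin 2, degreeOf j n = 0 := by
    intro j
    fin_cases j
    · exact hz 1 0 (by decide)
    · exact hz 0 1 (by decide)
  have ht : n.totalDegree = 0 := by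
    rw [totalDegree_eq_zero_iff]
    intro m hm x
    have := degreeOf_le_iff.mp (h0 x).le m hm
    omega
  rw [totalDegree_eq_zero_iff_eq_C] at ht
  apply hn.not_isUnit
  rw [ht]
  refine (IsUnit.mk0 _ ?_).map _
  intro h'
  apply hn.ne_zero
  rw [ht, h', map_zero]

open MvPolynomial in
theorem hl_nilp_of_gen {F : Type} [Field F]
    (D : Derivation F (MvPolynomial (Fin 2) F) (MvPolynomial (Fin 2) F))
    (h : ∀ i, ∃ n : ℕ, (⇑D)^[n] (X i) = 0) : HLND D := by
  have up : ∀ (m n : ℕ) (a : MvPolynomial (Fin 2) F), (⇑D)^[n] a = 0 → (⇑D)^[m + n] a = 0 := by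
    intro m n a ha
    rw [Function.iterate_add_apply, ha]
    exact iterate_map_zero D m
  intro a
  induction a using MvPolynomial.induction_on with
  | C r => exact ⟨1, by simp [derivation_C]⟩
  | add p q hp hq =>
    obtain ⟨m, hm⟩ := hp
    obtain ⟨n, hn⟩ := hq
    refine ⟨m + n, ?_⟩
    have e : (⇑D)^[m + n] (p + q) = (⇑D)^[m + n] p + (⇑D)^[m + n] q := iterate_map_add D _ p q
    rw [e, up m n q hn, add_comm m n, up n m p hm, add_zero]
  | mul_X p i hp =>
    obtain ⟨m, hm⟩ := hp
    obtain ⟨n, hn⟩ := h i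
    refine ⟨m + n + 1, (hl_leibniz D _ m n rfl _ _ ?_ ?_).2⟩
    · rw [add_comm]; exact up 1 m p hm
    · rw [add_comm]; exact up 1 n _ hn

open MvPolynomial in
theorem hl_der_eq {k : Type} [CommRing k] {M : Type} [CommRing M] [Algebra k M]
    [Algebra (MvPolynomial (Fin 2) k) M] [IsScalarTower k (MvPolynomial (Fin 2) k) M]
    (D : Derivation k (MvPolynomial (Fin 2) k) M) (f : MvPolynomial (Fin 2) k) :
    D f = pderiv 0 f • D (X 0) + pderiv 1 f • D (X 1) := by
  induction f using MvPolynomial.induction_on with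
  | C r => simp [derivation_C]
  | add p q hp hq =>
    rw [map_add, hp, hq, map_add, map_add]
    simp only [add_smul]
    abel
  | mul_X p i hp =>
    rw [D.leibniz, hp, pderiv_mul, pderiv_mul]
    fin_cases i
    · simp [pderiv_X, Algebra.smul_def]; ring
    · simp [pderiv_X, Algebra.smul_def]; ring

open MvPolynomial in
theorem hl_clear {R : Type} [CommRing R] [IsDomain R] (f : MvPolynomial (Fin 2) (FractionRing R)) :
    ∃ (s : MvPolynomial (Fin 2) R) (r : R), r ≠ 0 ∧
      f * C (algebraMap R (FractionRing R) r) = map (algebraMap R (FractionRing R)) s := by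
  induction f using MvPolynomial.induction_on with
  | C x =>
    obtain ⟨⟨a, b⟩, h⟩ := IsLocalization.surj (nonZeroDivisors R) x
    exact ⟨C a, b, nonZeroDivisors.ne_zero b.2, by rw [← map_mul, h, map_C]⟩
  | add p q hp hq =>
    obtain ⟨s, r, hr, h⟩ := hp
    obtain ⟨s', r', hr', h'⟩ := hq
    refine ⟨s * C r' + s' * C r, r * r', mul_ne_zero hr hr', ?_⟩
    simp only [map_add, map_mul, ← h, ← h', map_C]
    ring
  | mul_X p i hp =>
    obtain ⟨s, r, hr, h⟩ := hp
    refine ⟨s * X i, r, hr, ?_⟩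
    rw [map_mul, ← h, map_X]
    ring

open MvPolynomial in
set_option maxHeartbeats 1000000 in
/-- An irreducible locally nilpotent derivation of `R[v,w]` has a local slice over `R`. -/
theorem hl_local_slice {R : Type} [CommRing R] [IsDomain R] [CharZero R]
    [UniqueFactorizationMonoid R]
    (D : Derivation R (MvPolynomial (Fin 2) R) (MvPolynomial (Fin 2) R)) (hD : D ≠ 0)
    (hln : HLND D) (hirr : ∀ d, (∀ a, d ∣ D a) → IsUnit d) :
    ∃ s r, r ≠ 0 ∧ D s = C r := by
  let k := FractionRing R
  let F := AlgebraicClosure k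
  let ι : R →+* F := (algebraMap k F).comp (algebraMap R k)
  have hι : Function.Injective ι :=
    (algebraMap k F).injective.comp (IsFractionRing.injective R k)
  have : CharZero F := charZero_of_injective_ringHom hι
  let μ : MvPolynomial (Fin 2) R →+* MvPolynomial (Fin 2) F := map ι
  have hμ : Function.Injective μ := map_injective ι hι
  let E : Derivation F (MvPolynomial (Fin 2) F) (MvPolynomial (Fin 2) F) :=
    mkDerivation F (fun i => μ (D (X i)))
  have hE : ∀ a, E (μ a) = μ (D a) := by
    intro a
    rw [hl_der_eq E, hl_der_eq D]
    simp only [μ, pderiv_map, smul_eq_mul, map_add, map_mul, E, mkDerivation_X]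
  have hEit : ∀ n a, (⇑E)^[n] (μ a) = μ ((⇑D)^[n] a) := by
    intro n
    induction n with
    | zero => intro a; rfl
    | succ n ih => intro a; rw [Function.iterate_succ_apply, hE, ih, Function.iterate_succ_apply]
  have hEln : HLND E := by
    apply hl_nilp_of_gen
    intro i
    obtain ⟨n, hn⟩ := hln (X i)
    refine ⟨n, ?_⟩
    have := hEit n (X i)
    rw [hn, map_zero] at this
    rw [← this]
    simp [μ]
  obtain ⟨a0, ha0⟩ : ∃ a, D a ≠ 0 := by
    by_contra! h
    exact hD (Derivation.ext h)
  have hE0 : E ≠ 0 := by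
    intro h
    apply ha0
    apply hμ
    rw [← hE, h, map_zero]
    rfl
  obtain ⟨s, hs⟩ : ∃ s, E s = 1 := by
    refine hl_slice E hE0 hEln ?_
    intro n hn hdiv
    let Q := Ideal.span {n}
    have hQ : ∀ b, b ∈ Q ↔ n ∣ b := fun b => Ideal.mem_span_singleton
    have hQp : Q.IsPrime := (Ideal.span_singleton_prime hn.ne_zero).mpr hn
    let N : Ideal (MvPolynomial (Fin 2) R) := Q.comap μ
    have hNp : N.IsPrime := Ideal.comap_isPrime μ Q
    have hN : ∀ b, b ∈ N ↔ n ∣ μ b := fun b => by rw [← hQ]; rfl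
    have hDN : ∀ b, D b ∈ N := fun b => by rw [hN, ← hE]; exact hdiv _
    obtain ⟨m, hm, hmN, -⟩ := hl_prime_factor N (D a0) ha0 (hDN a0)
    obtain ⟨i, hi⟩ : ∃ i : Fin 2, ∀ g : Polynomial R, ev1h C (X i) g ∈ N → g = 0 := by
      by_contra! hcon
      apply hl_const_of_dvd n hn
      intro i
      obtain ⟨g, hg, hg0⟩ := hcon i
      refine ⟨g.map ι, (Polynomial.map_ne_zero_iff hι).mpr hg0, ?_⟩
      rw [hN] at hg
      convert hg using 1
      simp only [Polynomial.coe_eval₂RingHom, Polynomial.hom_eval₂, Polynomial.aeval_def,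
        Polynomial.eval₂_map]
      congr 1
      · ext x; simp [μ, algebraMap_eq]
      · simp [μ]
    apply hm.not_isUnit
    apply hirr
    intro b
    obtain ⟨G, hG, hG0⟩ := hl_dep3 (X i) (D b) m
    obtain ⟨g, hg, hgd⟩ := hl_cancel _ m hm.ne_zero _ G rfl hG hG0
    exact hl_prime_dvd (ev1h C (X i)) N hi m (D b) hm hmN (hDN b) _ g rfl hg hgd
  obtain ⟨Λ, h1, hadd, hmul, hpd⟩ := hl_retract (k := k) (F := F)
  let ν : MvPolynomial (Fin 2) R →+* MvPolynomial (Fin 2) k := map (algebraMap R k)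
  have hν : Function.Injective ν := map_injective _ (IsFractionRing.injective R k)
  have hμν : ∀ a, μ a = map (algebraMap k F) (ν a) := by
    intro a
    simp only [μ, ν, map_map]
    congr 1
  have hk : pderiv 0 (Λ s) * ν (D (X 0)) + pderiv 1 (Λ s) * ν (D (X 1)) = 1 := by
    rw [hl_der_eq E] at hs
    simp only [E, mkDerivation_X, smul_eq_mul, hμν] at hs
    rw [← h1, ← hs, hadd, hmul, hmul, hpd, hpd]
  obtain ⟨s', r0, hr0, hr'⟩ := hl_clear (Λ s)
  change Λ s * C (algebraMap R k r0) = ν s' at hr'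
  refine ⟨s', r0, hr0, ?_⟩
  apply hν
  have hp : ∀ i, ν (pderiv i s') = pderiv i (Λ s) * C (algebraMap R k r0) := by
    intro i
    have : pderiv i (ν s') = ν (pderiv i s') := pderiv_map
    rw [← this, ← hr', pderiv_mul, pderiv_C, mul_zero, add_zero]
  rw [hl_der_eq D, smul_eq_mul, smul_eq_mul, map_add, map_mul, map_mul, hp, hp]
  have : ν (C r0) = C (algebraMap R k r0) := by simp [ν]
  rw [this]
  linear_combination C (algebraMap R k r0) * hk

/-- A surjective endomorphism of a noetherian ring is injective. -/
theorem hl_inj {B : Type} [CommRing B] [IsNoetherianRing B] (f : B →+* B)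
    (hf : Function.Surjective f) : Function.Injective f := by
  let κ : ℕ →o Ideal B :=
    { toFun := fun n => RingHom.ker (f ^ n)
      monotone' := by
        refine monotone_nat_of_le_succ fun n a ha => ?_
        rw [RingHom.mem_ker] at ha ⊢
        rw [pow_succ', RingHom.mul_def, RingHom.comp_apply, ha, map_zero] }
  obtain ⟨n, hn⟩ := monotone_stabilizes_iff_noetherian.mpr ‹IsNoetherianRing B› κ
  rw [injective_iff_map_eq_zero]
  intro a ha
  obtain ⟨b, hb⟩ : ∃ b, (f ^ n) b = a := by
    have : Function.Surjective (f ^ n) := by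
      rw [RingHom.coe_pow]
      exact hf.iterate n
    exact this a
  have h1 : b ∈ κ (n + 1) := by
    change (f ^ (n + 1)) b = 0
    rw [pow_succ', RingHom.mul_def, RingHom.comp_apply, hb, ha]
  rw [← hn (n + 1) (by omega)] at h1
  rw [← hb]
  exact h1

open MvPolynomial in
/-- Coordinates identify `K[x,y,z]` with `K[u][v,w]`. -/
theorem hl_equiv {k : Type} [Field k] (u : PolyR k) (hu : IsCoord k u) :
    ∃ e : PolyR k ≃ₐ[k] MvPolynomial (Fin 2) (Polynomial k),
      ∀ r : Polynomial k, e.symm (C r) = Polynomial.aeval u r := by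
  obtain ⟨g, h, hgen⟩ := hu
  let y : Option (Fin 2) → PolyR k := fun o => o.elim u ![g, h]
  have hsurj : Function.Surjective (aeval (R := k) y) := by
    rw [← AlgHom.range_eq_top, eq_top_iff, ← hgen, Algebra.adjoin_le_iff]
    rintro x (rfl | rfl | rfl)
    · exact ⟨X none, by simp [y]⟩
    · exact ⟨X (some 0), by simp [y]⟩
    · exact ⟨X (some 1), by simp [y]⟩
  let ren : PolyR k ≃ₐ[k] MvPolynomial (Option (Fin 2)) k :=
    renameEquiv k (_root_.finSuccEquiv 2)
  have hinj : Function.Injective (aeval (R := k) y) := by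
    let f : PolyR k →+* PolyR k := ((aeval (R := k) y).comp ren.toAlgHom).toRingHom
    have hf : Function.Surjective f := by
      change Function.Surjective ((aeval (R := k) y) ∘ ren)
      exact hsurj.comp ren.surjective
    have hfi : Function.Injective f := hl_inj f hf
    intro a b hab
    obtain ⟨a', rfl⟩ := ren.surjective a
    obtain ⟨b', rfl⟩ := ren.surjective b
    exact congrArg ren (hfi hab)
  let e1 : MvPolynomial (Option (Fin 2)) k ≃ₐ[k] PolyR k :=
    AlgEquiv.ofBijective (aeval (R := k) y) ⟨hinj, hsurj⟩
  refine ⟨e1.symm.trans (optionEquivRight k (Fin 2)), ?_⟩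
  intro r
  have h2 : optionEquivRight k (Fin 2) (Polynomial.aeval (X none) r) = C r := by
    induction r using Polynomial.induction_on' with
    | add p q hp hq => rw [map_add, map_add, hp, hq, map_add]
    | monomial n a =>
      rw [Polynomial.aeval_monomial, map_mul, map_pow, optionEquivRight_X_none,
        algebraMap_eq, optionEquivRight_C, ← map_pow, ← map_mul, Polynomial.C_mul_X_pow_eq_monomial]
  rw [← h2]
  change e1 ((optionEquivRight k (Fin 2)).symm _) = _
  rw [AlgEquiv.symm_apply_apply]
  change aeval y (Polynomial.aeval (X none) r) = _
  rw [← Polynomial.aeval_algHom_apply]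
  simp [y]

/-- Derivation transported along the coordinate identification. -/
theorem hl_transport {k : Type} [Field k] (D : Derivation k (PolyR k) (PolyR k))
    (u : PolyR k) (hDu : D u = 0) (e : PolyR k ≃ₐ[k] MvPolynomial (Fin 2) (Polynomial k))
    (he : ∀ r : Polynomial k, e.symm (MvPolynomial.C r) = Polynomial.aeval u r) :
    ∃ D' : Derivation (Polynomial k) (MvPolynomial (Fin 2) (Polynomial k))
      (MvPolynomial (Fin 2) (Polynomial k)), ∀ a, D' a = e (D (e.symm a)) := by
  let l : MvPolynomial (Fin 2) (Polynomial k) →ₗ[Polynomial k]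
      MvPolynomial (Fin 2) (Polynomial k) :=
    { toFun := fun a => e (D (e.symm a))
      map_add' := fun a b => by simp
      map_smul' := fun r a => by
        rw [MvPolynomial.smul_eq_C_mul, MvPolynomial.smul_eq_C_mul, map_mul, D.leibniz, he,
          D.map_aeval, hDu, smul_zero, smul_zero, add_zero, smul_eq_mul, map_mul, ← he,
          AlgEquiv.apply_symm_apply]
        rfl }
  refine ⟨Derivation.mk' l ?_, fun a => rfl⟩
  intro a b
  change e (D (e.symm (a * b))) = a • e (D (e.symm b)) + b • e (D (e.symm a))
  rw [map_mul, D.leibniz]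
  simp

/-- If `u` is a coordinate of `K[x,y,z]` killed by a nonzero irreducible locally
nilpotent derivation `X`, then the constants of `X` are `K[u,p]` for some `p`, and
every generator of the plinth ideal lies in `K[u]`. -/
theorem plinth_gen_in_Ku {K : Type} [Field K] [CharZero K]
    (X : Derivation K (PolyR K) (PolyR K)) (hX : X ≠ 0)
    (hln : LND K X) (hirr : IrredDer K X)
    (u : PolyR K) (hu : IsCoord K u) (hXu : X u = 0) :
    (∃ p : PolyR K,
      {a : PolyR K | X a = 0} = (Algebra.adjoin K {u, p} : Subalgebra K (PolyR K))) ∧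
    ∀ c : PolyR K, IsPlinthGen K X c → ∃ ℓ : Polynomial K, c = Polynomial.aeval u ℓ := by
  obtain ⟨e, he⟩ := hl_equiv u hu
  obtain ⟨D, hD⟩ := hl_transport X u hXu e he
  have hDe : ∀ a, D (e a) = e (X a) := fun a => by rw [hD, AlgEquiv.symm_apply_apply]
  have hD0 : D ≠ 0 := by
    intro h
    apply hX
    refine Derivation.ext fun a => ?_
    have := hDe a
    rw [h] at this
    apply e.injective
    rw [← this]
    simp
  have hit : ∀ n a, (⇑D)^[n] (e a) = e ((⇑X)^[n] a) := by
    intro n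
    induction n with
    | zero => intro a; rfl
    | succ n ih => intro a; rw [Function.iterate_succ_apply, hDe, ih, Function.iterate_succ_apply]
  have hDln : HLND D := by
    intro a
    obtain ⟨n, -, hn⟩ := hln (e.symm a)
    refine ⟨n, ?_⟩
    have := hit n (e.symm a)
    rw [AlgEquiv.apply_symm_apply, hn, map_zero] at this
    exact this
  have hDirr : ∀ d, (∀ a, d ∣ D a) → IsUnit d := by
    intro d hd
    have : IsUnit (e.symm d) := by
      apply hirr
      intro i
      have := map_dvd e.symm (hd (e (MvPolynomial.X i)))
      rwa [hDe, AlgEquiv.symm_apply_apply] at this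
    have := this.map e
    rwa [AlgEquiv.apply_symm_apply] at this
  constructor
  · obtain ⟨p, hp, hker⟩ := hl_kernel D hD0 hDln
    refine ⟨e.symm p, ?_⟩
    have hXp : X (e.symm p) = 0 := by
      apply e.injective
      rw [← hD, hp, map_zero]
    ext a
    simp only [Set.mem_ofPred_eq, SetLike.mem_coe]
    constructor
    · intro ha
      obtain ⟨q, hq⟩ := hker (e a) (by rw [hDe, ha, map_zero])
      have : a = e.symm (Polynomial.aeval p q) := by rw [← hq, AlgEquiv.symm_apply_apply]
      rw [this]
      clear this hq
      induction q using Polynomial.induction_on' with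
      | add f g hf hg =>
        rw [map_add, map_add]
        exact add_mem hf hg
      | monomial n r =>
        rw [Polynomial.aeval_monomial, map_mul, map_pow, MvPolynomial.algebraMap_eq, he]
        refine mul_mem ?_ (pow_mem (Algebra.subset_adjoin (by simp)) n)
        exact Algebra.adjoin_mono (by simp) (Polynomial.aeval_mem_adjoin_singleton K u)
    · intro ha
      induction ha using Algebra.adjoin_induction with
      | mem x hx =>
        rcases hx with rfl | rfl
        · exact hXu
        · exact hXp
      | algebraMap r => exact X.map_algebraMap r
      | add x y _ _ hx hy => rw [map_add, hx, hy, add_zero]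
      | mul x y _ _ hx hy => rw [X.leibniz, hx, hy, smul_zero, smul_zero, add_zero]
  · intro c hc
    obtain ⟨s, r, hr, hs⟩ := hl_local_slice D hD0 hDln hDirr
    have hXs : X (e.symm s) = Polynomial.aeval u r := by
      apply e.injective
      rw [← hD, hs, ← he, AlgEquiv.apply_symm_apply]
    have hmem : X (e.symm s) ∈ {d : PolyR K | ∃ a : PolyR K, X a = d ∧ X (X a) = 0} :=
      ⟨e.symm s, rfl, by rw [hXs, X.map_aeval, hXu, smul_zero]⟩
    rw [hc] at hmem
    obtain ⟨t, -, ht⟩ := hmem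
    have hCr : MvPolynomial.C r = e t * e c := by
      rw [← map_mul, ← ht, hXs, ← he, AlgEquiv.apply_symm_apply]
    have hne : e t * e c ≠ 0 := by
      rw [← hCr]
      simpa using hr
    have hdeg := MvPolynomial.totalDegree_mul_of_isDomain (left_ne_zero_of_mul hne)
      (right_ne_zero_of_mul hne)
    rw [← hCr, MvPolynomial.totalDegree_C] at hdeg
    have hc0 : (e c).totalDegree = 0 := by omega
    rw [MvPolynomial.totalDegree_eq_zero_iff_eq_C] at hc0
    refine ⟨MvPolynomial.coeff 0 (e c), ?_⟩
    rw [← he, ← hc0, AlgEquiv.symm_apply_apply]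

end
end
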